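/- arXiv:2104.10101 — 2 statements merged into one kernel-verified Lean document; each statement's English description precedes it below -/
import Mathlib

section
/- Let α, β ∈ ℤ_{≥0}^n with [x^β]κ_α > 0. Suppose i < j and β_j − β_i = t ∈ ℤ_{>0}. Then for every 1 ≤ s ≤ t, the composition β′ obtained from β by replacing β_i with β_i + s and β_j with β_j − s satisfies [x^{β′}]κ_α > 0. -/
open scoped Classical

namespace LSS

noncomputable section

open MvPolynomial

/-- The simple transposition `s_i ∈ S_n` (`1 ≤ i ≤ n-1`, 1-indexed): it exchanges the
letters `i` and `i+1` of `[n] = {1, …, n}`, realized on `Fin n` (0-indexed) as the swap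
of `i-1` and `i`. For `i` out of range it is the identity. -/
def st (n : ℕ) (i : ℕ) : Equiv.Perm (Fin n) :=
  if h : 0 < i ∧ i < n then Equiv.swap ⟨i - 1, by omega⟩ ⟨i, h.2⟩ else 1

/-- Coxeter length of `w ∈ S_n` = number of inversions. -/
def len (n : ℕ) (w : Equiv.Perm (Fin n)) : ℕ :=
  (Finset.univ.filter fun p : Fin n × Fin n => p.1 < p.2 ∧ w p.2 < w p.1).card

/-- `L` is a reduced word for `w`: a list of indices in `[n-1]` of length `ℓ(w)` whose
associated product of simple transpositions is `w`. -/
def IsRedWord (n : ℕ) (L : List ℕ) (w : Equiv.Perm (Fin n)) : Prop :=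
  (∀ i ∈ L, 1 ≤ i ∧ i ≤ n - 1) ∧ (L.map (st n)).prod = w ∧ L.length = len n w

/-- The left descent set `J(w) = {j ∈ [n-1] : ℓ(s_j w) < ℓ(w)}`. -/
def Descents (n : ℕ) (w : Equiv.Perm (Fin n)) : Set ℕ :=
  {j | 1 ≤ j ∧ j ≤ n - 1 ∧ len n (st n j * w) < len n w}

/-- The parabolic subgroup of `S_n` generated by `{s_i : i ∈ I}`. -/
def parab (n : ℕ) (I : Set ℕ) : Subgroup (Equiv.Perm (Fin n)) :=
  Subgroup.closure (st n '' I)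

/-- `u = w_0(I)`, the longest element of the parabolic subgroup generated by `{s_i : i ∈ I}`. -/
def IsLongest (n : ℕ) (I : Set ℕ) (u : Equiv.Perm (Fin n)) : Prop :=
  u ∈ parab n I ∧ ∀ v ∈ parab n I, len n v ≤ len n u

/-- `c` is a standard Coxeter element of some parabolic subgroup of `S_n`: a product of
the elements of some subset of `{s_1, …, s_{n-1}}`, each appearing exactly once, in some order. -/
def IsStdCox (n : ℕ) (c : Equiv.Perm (Fin n)) : Prop :=
  ∃ L : List ℕ, L.Nodup ∧ (∀ i ∈ L, 1 ≤ i ∧ i ≤ n - 1) ∧ (L.map (st n)).prod = c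

/-- A weak composition `β : Fin n → ℕ` as an exponent vector. -/
def expOf (n : ℕ) (β : Fin n → ℕ) : Fin n →₀ ℕ := Finsupp.equivFunOnFinite.symm β

/-- The monomial `x^β = x_1^{β_1} ⋯ x_n^{β_n}`. -/
def mono (n : ℕ) (β : Fin n → ℕ) : MvPolynomial (Fin n) ℤ := monomial (expOf n β) 1

/-- The coefficient `[x^β] f`. -/
def coeffOf (n : ℕ) (β : Fin n → ℕ) (f : MvPolynomial (Fin n) ℤ) : ℤ := coeff (expOf n β) f

/-- The isobaric divided difference (Demazure) operator
`π_i(f) = (x_i f − x_{i+1} s_i f)/(x_i − x_{i+1})` (1-indexed `i`), defined as the unique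
polynomial `g` with `(x_i − x_{i+1})·g = x_i f − x_{i+1} s_i f`; such a `g` always exists
and is unique since `ℤ[x_1,…,x_n]` is a domain. -/
def dem (n : ℕ) (i : ℕ) (f : MvPolynomial (Fin n) ℤ) : MvPolynomial (Fin n) ℤ :=
  if h : 0 < i ∧ i < n then
    if hg : ∃ g, (X (⟨i - 1, by omega⟩ : Fin n) - X (⟨i, h.2⟩ : Fin n)) * g =
        X (⟨i - 1, by omega⟩ : Fin n) * f -
          X (⟨i, h.2⟩ : Fin n) *
            rename (⇑(Equiv.swap (⟨i - 1, by omega⟩ : Fin n) (⟨i, h.2⟩ : Fin n))) f then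
      hg.choose
    else 0
  else f

/-- `π_{i_1} π_{i_2} ⋯ π_{i_ℓ} (f)` for a word `L = [i_1, …, i_ℓ]`. -/
def demWord (n : ℕ) (L : List ℕ) (f : MvPolynomial (Fin n) ℤ) : MvPolynomial (Fin n) ℤ :=
  L.foldr (dem n) f

/-- Entry accessor for a composition, 0-indexed position, default `0` out of range. -/
def ent (n : ℕ) (α : Fin n → ℕ) (p : ℕ) : ℕ := if h : p < n then α ⟨p, h⟩ else 0

/-- Exchange the entries of `α` in (0-indexed) positions `p` and `p+1`. -/
def swapAt (n : ℕ) (p : ℕ) (α : Fin n → ℕ) : Fin n → ℕ := fun m =>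
  if (m : ℕ) = p then ent n α (p + 1) else if (m : ℕ) = p + 1 then ent n α p else α m

/-- Auxiliary fuelled recursion computing the key polynomial `κ_α`:
if `α` is weakly decreasing, `κ_α = x^α`; otherwise, choosing an ascent `α_p < α_{p+1}`
(0-indexed `p`), `κ_α = π_{p+1}(κ_{α̂})` where `α̂` swaps the two entries.  The fuel
`n*n` in `keyPoly` strictly exceeds the number of co-inversions, which drops by one at
each step, so the recursion always terminates at a weakly decreasing composition. -/
def keyAux (n : ℕ) : ℕ → (Fin n → ℕ) → MvPolynomial (Fin n) ℤ
  | 0, α => mono n α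
  | k + 1, α =>
    if h : ∃ p : Fin n, ent n α p.1 < ent n α (p.1 + 1) then
      dem n (h.choose.1 + 1) (keyAux n k (swapAt n h.choose.1 α))
    else mono n α

/-- The key polynomial `κ_α`. -/
def keyPoly (n : ℕ) (α : Fin n → ℕ) : MvPolynomial (Fin n) ℤ := keyAux n (n * n) α

/-- `wλ`, the composition `(λ_{w⁻¹(1)}, …, λ_{w⁻¹(n)})`. -/
def pact (n : ℕ) (w : Equiv.Perm (Fin n)) (lam : Fin n → ℕ) : Fin n → ℕ :=
  fun i => lam (w⁻¹ i)

/-- `lam` is a partition (weakly decreasing vector) with at most `n` parts. -/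
def IsPartition (n : ℕ) (lam : Fin n → ℕ) : Prop := ∀ i j : Fin n, i ≤ j → lam j ≤ lam i

/-- Box `(c, r)` (column, row; both 1-indexed) belongs to the skyline diagram `D(α)`. -/
def InDiag (n : ℕ) (α : Fin n → ℕ) (c r : ℕ) : Prop :=
  1 ≤ c ∧ c ≤ n ∧ 1 ≤ r ∧ r ≤ ent n α (c - 1)

/-- `F` (value of box (column, row)) is a filling of `D(α)` that is flagged (labels in
column `c` are in `{1, …, c}`) and row distinct. -/
def IsTab (n : ℕ) (α : Fin n → ℕ) (F : ℕ → ℕ → ℕ) : Prop :=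
  (∀ c r, InDiag n α c r → 1 ≤ F c r ∧ F c r ≤ c) ∧
  ∀ c c' r, InDiag n α c r → InDiag n α c' r → c ≠ c' → F c r ≠ F c' r

/-- The weight of a filling: `wt(F)_i` = number of occurrences of the label `i`
(1-indexed; `Fin` position `i` records the label `i+1`). -/
def wt (n : ℕ) (α : Fin n → ℕ) (F : ℕ → ℕ → ℕ) : Fin n → ℕ := fun i =>
  ((Finset.Icc 1 n ×ˢ Finset.Icc 1 (Finset.univ.sup α)).filter fun p =>
    InDiag n α p.1 p.2 ∧ F p.1 p.2 = i.1 + 1).card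

/-- `leftmin_α(i) = min{α_j : j ≤ i}`. -/
def leftmin (n : ℕ) (α : Fin n → ℕ) (i : Fin n) : ℕ := sInf (α '' {j | j ≤ i})

/-- `rightmax_α(i) = max{α_j : j ≥ i}`. -/
def rightmax (n : ℕ) (α : Fin n → ℕ) (i : Fin n) : ℕ :=
  Finset.sup (Finset.univ.filter fun j => i ≤ j) α

/-- `d` records `0 = d_0 < d_1 < ⋯ < d_k < d_{k+1} = n`. -/
def BlockData (n k : ℕ) (d : Fin (k + 2) → ℕ) : Prop :=
  d 0 = 0 ∧ d (Fin.last (k + 1)) = n ∧ StrictMono d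

/-- `D = {d_1, …, d_k}` as a set of natural numbers. -/
def Dset (k : ℕ) (d : Fin (k + 2) → ℕ) : Set ℕ :=
  {m | ∃ t : Fin (k + 2), t ≠ 0 ∧ t ≠ Fin.last (k + 1) ∧ d t = m}

/-- `I = [n−1] ∖ D`. -/
def Iset (n k : ℕ) (d : Fin (k + 2) → ℕ) : Set ℕ :=
  {m | 1 ≤ m ∧ m ≤ n - 1 ∧ m ∉ Dset k d}

/-- Positions `i, j` (of `Fin n`, 0-indexed; 1-indexed letters `i+1, j+1`) lie in the same
block: some `t` has `d_t < i+1, j+1 ≤ d_{t+1}`. -/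
def SameBlock (n k : ℕ) (d : Fin (k + 2) → ℕ) (i j : Fin n) : Prop :=
  ∃ t : Fin (k + 1), d t.castSucc ≤ i.1 ∧ i.1 < d t.succ ∧ d t.castSucc ≤ j.1 ∧ j.1 < d t.succ

/-- The variables `X_t = {x_{d_t + 1}, …, x_{d_{t+1}}}` of the `t`-th block. -/
def blockVars (n k : ℕ) (d : Fin (k + 2) → ℕ) (t : Fin (k + 1)) : Finset (Fin n) :=
  Finset.univ.filter fun p => d t.castSucc ≤ p.1 ∧ p.1 < d t.succ

/-- Complete homogeneous symmetric polynomial of degree `m` in the variables `S`. -/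
def hPoly (n : ℕ) (S : Finset (Fin n)) (m : ℕ) : MvPolynomial (Fin n) ℤ :=
  ∑ f ∈ S.sym m, ((f : Multiset (Fin n)).map X).prod

/-- `h_z` for `z : ℤ`, with `h_z = 0` for `z < 0`. -/
def hZ (n : ℕ) (S : Finset (Fin n)) (z : ℤ) : MvPolynomial (Fin n) ℤ :=
  if 0 ≤ z then hPoly n S z.toNat else 0

/-- The Schur polynomial `s_lam` in the variable set `S`, for a partition `lam`
(1-indexed parts, at most `t` of them), via the Jacobi–Trudi determinant
`det(h_{lam_i − i + j})_{1 ≤ i,j ≤ t}`. -/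
def schurP (n : ℕ) (S : Finset (Fin n)) (t : ℕ) (lam : ℕ → ℕ) : MvPolynomial (Fin n) ℤ :=
  (Matrix.of fun i j : Fin t =>
    hZ n S ((lam (i.1 + 1) : ℤ) - (i.1 + 1) + (j.1 + 1))).det

/-- `γ ∈ Par_D`: a `(k+1)`-tuple of partitions, the `t`-th having at most
`d_{t+1} − d_t` nonzero parts (1-indexed parts; the unused index `0` is normalized to `0`). -/
def ParD (k : ℕ) (d : Fin (k + 2) → ℕ) (γ : Fin (k + 1) → ℕ → ℕ) : Prop :=
  ∀ t : Fin (k + 1), γ t 0 = 0 ∧ (∀ a b : ℕ, 1 ≤ a → a ≤ b → γ t b ≤ γ t a) ∧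
    ∀ m : ℕ, d t.succ - d t.castSucc < m → γ t m = 0

/-- The `D`-Schur polynomial `s_{γ^1,…,γ^{k+1}} = ∏_t s_{γ^t}(X_t)`. -/
def dSchur (n k : ℕ) (d : Fin (k + 2) → ℕ) (γ : Fin (k + 1) → ℕ → ℕ) :
    MvPolynomial (Fin n) ℤ :=
  ∏ t : Fin (k + 1), schurP n (blockVars n k d t) (d t.succ - d t.castSucc) (γ t)

/-- Truncation of an integer vector to a natural-number vector. -/
def toNatV (n : ℕ) (β : Fin n → ℤ) : Fin n → ℕ := fun i => (β i).toNat

/-- `j − i` as an integer. -/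
def gapZ (n : ℕ) (i j : Fin n) : ℤ := (j.1 : ℤ) - (i.1 : ℤ)

/-- The move `t_{ij}`: replace `β_i` by `β_j − (j−i)` and `β_j` by `β_i + (j−i)`. -/
def tmv (n : ℕ) (i j : Fin n) (β : Fin n → ℤ) : Fin n → ℤ := fun m =>
  if m = i then β j - gapZ n i j else if m = j then β i + gapZ n i j else β m

/-- The rank `θ(β) = #{(a,b) : a < b in the same block and β_a < β_b − (b−a)}`. -/
def theta (n k : ℕ) (d : Fin (k + 2) → ℕ) (β : Fin n → ℤ) : ℕ :=
  (Finset.univ.filter fun p : Fin n × Fin n =>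
    p.1 < p.2 ∧ SameBlock n k d p.1 p.2 ∧ β p.1 < β p.2 - gapZ n p.1 p.2).card

/-- One step up in the Bruhat-type order: `β ⋖ t_{ij} β` whenever `i < j` are in the same
block and `β_i > β_j − (j−i)`. -/
def stepUp (n k : ℕ) (d : Fin (k + 2) → ℕ) (β β' : Fin n → ℤ) : Prop :=
  ∃ i j : Fin n, i < j ∧ SameBlock n k d i j ∧ β j - gapZ n i j < β i ∧ β' = tmv n i j β

/-- The order on compositions: transitive (reflexive) closure of `stepUp`. -/
def leB (n k : ℕ) (d : Fin (k + 2) → ℕ) : (Fin n → ℤ) → (Fin n → ℤ) → Prop :=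
  Relation.ReflTransGen (stepUp n k d)

/-- Membership in the poset `P_{α,γ}` (for `α = cλ`): `β` is a weak composition with
`[x^β] κ_α ≠ 0` and `π_{w_0(I)}(x^β) = ± s_γ`. -/
def memP (n k : ℕ) (d : Fin (k + 2) → ℕ) (w0I : Equiv.Perm (Fin n)) (α : Fin n → ℕ)
    (γ : Fin (k + 1) → ℕ → ℕ) (β : Fin n → ℤ) : Prop :=
  (∀ i, 0 ≤ β i) ∧ coeffOf n (toNatV n β) (keyPoly n α) ≠ 0 ∧
  ∃ L, IsRedWord n L w0I ∧
    (demWord n L (mono n (toNatV n β)) = dSchur n k d γ ∨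
     demWord n L (mono n (toNatV n β)) = -dSchur n k d γ)

/-- The pair `i < j` is interweaved for `α`: `α_m ≥ α_{m+1}` for `i ≤ m < j`,
`leftmin_α(i) < α_i` and `rightmax_α(j) > α_j`. -/
def Interweaved (n : ℕ) (α : Fin n → ℕ) (i j : Fin n) : Prop :=
  i < j ∧ (∀ p : Fin n, i ≤ p → p < j → ent n α (p.1 + 1) ≤ α p) ∧
  leftmin n α i < α i ∧ α j < rightmax n α j

/-- `center_α(i,j) = max{m : i ≤ m ≤ j and α_m ≥ rightmax_α(j)}` (as a 0-indexed position). -/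
def center (n : ℕ) (α : Fin n → ℕ) (i j : Fin n) : ℕ :=
  Finset.sup (Finset.univ.filter fun p : Fin n => i ≤ p ∧ p ≤ j ∧ rightmax n α j ≤ α p)
    fun p => p.1

/-- Partial sum `β_1 + ⋯ + β_{m+1}` (0-indexed positions `≤ m`) of an integer vector. -/
def psumZ (n : ℕ) (β : Fin n → ℤ) (m : ℕ) : ℤ :=
  ∑ p ∈ Finset.univ.filter (fun p : Fin n => p.1 ≤ m), β p

/-- Partial sum of a composition, as an integer. -/
def psumN (n : ℕ) (α : Fin n → ℕ) (m : ℕ) : ℤ :=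
  ∑ p ∈ Finset.univ.filter (fun p : Fin n => p.1 ≤ m), (α p : ℤ)

/-- Composition pattern containment. -/
def ContainsPat (n : ℕ) {m : ℕ} (α : Fin n → ℕ) (pat : Fin m → ℕ) : Prop :=
  ∃ g : Fin m → Fin n, StrictMono g ∧
    (∀ s t : Fin m, pat s ≤ pat t ↔ α (g s) ≤ α (g t)) ∧
    ∀ s t : Fin m, |(pat s : ℤ) - (pat t : ℤ)| ≤ |(α (g s) : ℤ) - (α (g t) : ℤ)|

end

end LSS

namespace LSS

/-- Number of elements of `A` below `k`. -/
def pref (A : Finset ℕ) (k : ℕ) : ℕ := (A.filter (· < k)).card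

/-- Exchange of `p` and `p+1` in a set. -/
def sw (p : ℕ) (A : Finset ℕ) : Finset ℕ := A.image (Equiv.swap p (p + 1))

/-- Indicator. -/
def ind (A : Finset ℕ) (k : ℕ) : ℕ := if k ∈ A then 1 else 0

/-- Gale order on sets of equal cardinality (as a comparison of counts below a bound). -/
def Le (A a : Finset ℕ) : Prop := A.card = a.card ∧ ∀ k, pref a k ≤ pref A k

lemma pref_zero (A : Finset ℕ) : pref A 0 = 0 := by simp [pref]

lemma pref_succ (A : Finset ℕ) (k : ℕ) : pref A (k + 1) = pref A k + ind A k := by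
  unfold pref ind
  by_cases h : k ∈ A
  · have : A.filter (· < k + 1) = insert k (A.filter (· < k)) := by
      ext x; simp only [Finset.mem_filter, Finset.mem_insert]
      constructor
      · rintro ⟨h1, h2⟩
        by_cases hx : x = k
        · exact Or.inl hx
        · exact Or.inr ⟨h1, by omega⟩
      · rintro (rfl | ⟨h1, h2⟩)
        · exact ⟨h, by omega⟩
        · exact ⟨h1, by omega⟩
    rw [this, Finset.card_insert_of_notMem (by simp), if_pos h]
  · have : A.filter (· < k + 1) = A.filter (· < k) := by
      ext x; simp only [Finset.mem_filter]
      constructor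
      · rintro ⟨h1, h2⟩
        refine ⟨h1, ?_⟩
        have : x ≠ k := by rintro rfl; exact h h1
        omega
      · rintro ⟨h1, h2⟩
        exact ⟨h1, by omega⟩
    rw [this, if_neg h, add_zero]

lemma pref_le_card (A : Finset ℕ) (k : ℕ) : pref A k ≤ A.card :=
  Finset.card_le_card (Finset.filter_subset _ _)

lemma pref_eq_card {A : Finset ℕ} {k : ℕ} (h : ∀ x ∈ A, x < k) : pref A k = A.card := by
  unfold pref; rw [Finset.filter_true_of_mem h]

lemma mem_sw (p : ℕ) (A : Finset ℕ) (x : ℕ) : x ∈ sw p A ↔ Equiv.swap p (p + 1) x ∈ A := by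
  unfold sw
  simp only [Finset.mem_image]
  constructor
  · rintro ⟨y, hy, rfl⟩; simpa using hy
  · intro h; exact ⟨_, h, by simp⟩

lemma ind_sw_ne {p : ℕ} (A : Finset ℕ) {k : ℕ} (h1 : k ≠ p) (h2 : k ≠ p + 1) :
    ind (sw p A) k = ind A k := by
  simp [ind, mem_sw, Equiv.swap_apply_of_ne_of_ne h1 h2]

lemma ind_sw_left (p : ℕ) (A : Finset ℕ) : ind (sw p A) p = ind A (p + 1) := by
  simp [ind, mem_sw]

lemma ind_sw_right (p : ℕ) (A : Finset ℕ) : ind (sw p A) (p + 1) = ind A p := by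
  simp [ind, mem_sw]

lemma ind_le_one (A : Finset ℕ) (k : ℕ) : ind A k ≤ 1 := by
  unfold ind; split_ifs <;> omega

lemma mem_iff_ind (A : Finset ℕ) (k : ℕ) : k ∈ A ↔ ind A k = 1 := by
  unfold ind; split_ifs with h <;> simp [h]

lemma ext_ind {A B : Finset ℕ} (h : ∀ k, ind A k = ind B k) : A = B := by
  ext k; rw [mem_iff_ind, mem_iff_ind, h]

lemma sw_sw (p : ℕ) (A : Finset ℕ) : sw p (sw p A) = A := by
  ext x; simp [mem_sw]

lemma card_sw (p : ℕ) (A : Finset ℕ) : (sw p A).card = A.card :=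
  Finset.card_image_of_injective _ (Equiv.injective _)

lemma pref_sw_ne (p : ℕ) (A : Finset ℕ) (k : ℕ) (h : k ≠ p + 1) :
    pref (sw p A) k = pref A k := by
  have h1 : ∀ k, k ≤ p → pref (sw p A) k = pref A k := by
    intro k
    induction k with
    | zero => simp [pref_zero]
    | succ k ih =>
      intro hk
      rw [pref_succ, pref_succ, ih (by omega), ind_sw_ne _ (by omega) (by omega)]
  have h2 : ∀ d, pref (sw p A) (p + 2 + d) = pref A (p + 2 + d) := by
    intro d
    induction d with
    | zero =>
      have := h1 p le_rfl
      have e1 := pref_succ (sw p A) (p + 1)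
      have e2 := pref_succ (sw p A) p
      have e3 := pref_succ A (p + 1)
      have e4 := pref_succ A p
      rw [ind_sw_right] at e1
      rw [ind_sw_left] at e2
      show pref (sw p A) (p + 1 + 1) = pref A (p + 1 + 1)
      omega
    | succ d ih =>
      show pref (sw p A) (p + 2 + d + 1) = pref A (p + 2 + d + 1)
      rw [pref_succ, pref_succ, ih, ind_sw_ne _ (by omega) (by omega)]
  rcases Nat.lt_or_ge k (p + 2) with h3 | h3
  · exact h1 k (by omega)
  · obtain ⟨d, rfl⟩ := Nat.exists_eq_add_of_le h3
    exact h2 d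

lemma pref_sw_self (p : ℕ) (A : Finset ℕ) :
    pref (sw p A) (p + 1) = pref A p + ind A (p + 1) := by
  rw [pref_succ, pref_sw_ne _ _ _ (by omega), ind_sw_left]

/-- Hypothesis: `a` (row of `α`) has `p ∈ a → p+1 ∈ a`, `A` has `p+1 ∈ A → p ∈ A`. -/
lemma Le_lift {p : ℕ} {A a : Finset ℕ} (hA : ind A (p + 1) ≤ ind A p)
    (ha : ind a p ≤ ind a (p + 1)) :
    (Le A (sw p a) ↔ Le A a) ∧ (Le (sw p A) a ↔ Le A a) := by
  have e1 := pref_succ A p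
  have e2 := pref_succ A (p + 1)
  have e3 := pref_succ a p
  have e4 := pref_succ a (p + 1)
  have e5 := pref_sw_self p A
  have e6 := pref_sw_self p a
  have b1 := ind_le_one A p
  have b2 := ind_le_one A (p + 1)
  have b3 := ind_le_one a p
  have b4 := ind_le_one a (p + 1)
  unfold Le
  rw [card_sw, card_sw]
  refine ⟨and_congr_right fun _ => ⟨fun h k => ?_, fun h k => ?_⟩,
    and_congr_right fun _ => ⟨fun h k => ?_, fun h k => ?_⟩⟩
  all_goals
    by_cases hk : k = p + 1
    · subst hk
      have h0 := h p
      have h1 := h (p + 1)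
      have h2 := h (p + 1 + 1)
      try rw [pref_sw_ne _ _ p (by omega)] at h0
      try rw [pref_sw_ne _ _ (p + 1 + 1) (by omega)] at h2
      omega
    · have h0 := h k
      try rw [pref_sw_ne _ _ k hk] at h0
      try rw [pref_sw_ne _ _ k hk]
      exact h0

lemma Le_unsw {p : ℕ} {A a : Finset ℕ} (hA : ind A (p + 1) ≤ ind A p)
    (h : Le (sw p A) a) : Le A a := by
  refine ⟨by rw [← card_sw p A]; exact h.1, fun k => ?_⟩
  have h0 := h.2 k
  by_cases hk : k = p + 1
  · subst hk
    rw [pref_sw_self] at h0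
    rw [pref_succ A]; omega
  · rwa [pref_sw_ne _ _ _ hk] at h0

/-- Queue length process. -/
def qu (A C : Finset ℕ) : ℕ → ℕ
  | 0 => 0
  | k + 1 => qu A C k + ind A k - ind C k

/-- Departure process. -/
def dep (A C : Finset ℕ) : Finset ℕ := C.filter fun k => 1 ≤ qu A C k + ind A k

lemma ind_dep (A C : Finset ℕ) (k : ℕ) :
    ind (dep A C) k = ind C k * min 1 (qu A C k + ind A k) := by
  by_cases h : k ∈ C <;> by_cases h' : 1 ≤ qu A C k + ind A k
  · have : k ∈ dep A C := Finset.mem_filter.2 ⟨h, h'⟩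
    rw [(mem_iff_ind _ _).1 this, (mem_iff_ind _ _).1 h]; omega
  · have : k ∉ dep A C := fun hh => h' (Finset.mem_filter.1 hh).2
    rw [show ind (dep A C) k = 0 from if_neg this, (mem_iff_ind _ _).1 h]; omega
  · have : k ∉ dep A C := fun hh => h (Finset.mem_filter.1 hh).1
    rw [show ind (dep A C) k = 0 from if_neg this, show ind C k = 0 from if_neg h]; omega
  · have : k ∉ dep A C := fun hh => h (Finset.mem_filter.1 hh).1
    rw [show ind (dep A C) k = 0 from if_neg this, show ind C k = 0 from if_neg h]; omega

lemma ind_cases (C : Finset ℕ) (k : ℕ) : ind C k = 0 ∨ ind C k = 1 := by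
  have := ind_le_one C k; omega

lemma qu_congr_lt {A A' C C' : Finset ℕ} {p : ℕ} (hA : ∀ k, k < p → ind A k = ind A' k)
    (hC : ∀ k, k < p → ind C k = ind C' k) : ∀ k, k ≤ p → qu A C k = qu A' C' k := by
  intro k
  induction k with
  | zero => intro _; rfl
  | succ k ih =>
    intro hk
    simp only [qu]
    rw [ih (by omega), hA k (by omega), hC k (by omega)]

lemma qu_congr_ge {A A' C C' : Finset ℕ} {p : ℕ} (hA : ∀ k, p ≤ k → ind A k = ind A' k)
    (hC : ∀ k, p ≤ k → ind C k = ind C' k) (h : qu A C p = qu A' C' p) :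
    ∀ k, p ≤ k → qu A C k = qu A' C' k := by
  intro k hk
  induction k, hk using Nat.le_induction with
  | base => exact h
  | succ k hk ih =>
    simp only [qu]
    rw [ih, hA k hk, hC k hk]

/-- Comparison of departures for inputs agreeing off `p, p+1`. -/
lemma dep_compare {p : ℕ} {A A' C C' : Finset ℕ}
    (hA : ∀ k, k ≠ p → k ≠ p + 1 → ind A k = ind A' k)
    (hC : ∀ k, k ≠ p → k ≠ p + 1 → ind C k = ind C' k)
    (h : qu A C p = qu A' C' p → qu A C (p + 2) = qu A' C' (p + 2)) :
    qu A C p = qu A' C' p ∧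
    ∀ k, k ≠ p → k ≠ p + 1 → ind (dep A C) k = ind (dep A' C') k := by
  have hlt := qu_congr_lt (p := p) (fun k hk => hA k (by omega) (by omega))
    (fun k hk => hC k (by omega) (by omega))
  have hge := qu_congr_ge (p := p + 2) (fun k hk => hA k (by omega) (by omega))
    (fun k hk => hC k (by omega) (by omega)) (h (hlt p le_rfl))
  refine ⟨hlt p le_rfl, fun k h1 h2 => ?_⟩
  rw [ind_dep, ind_dep, hA k h1 h2, hC k h1 h2]
  rcases Nat.lt_or_ge k (p + 2) with h3 | h3
  · rw [hlt k (by omega)]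
  · rw [hge k h3]

lemma ext_three {p : ℕ} {A B : Finset ℕ} (h : ∀ k, k ≠ p → k ≠ p + 1 → ind A k = ind B k)
    (h1 : ind A p = ind B p) (h2 : ind A (p + 1) = ind B (p + 1)) : A = B := by
  apply ext_ind
  intro k
  by_cases hk : k = p
  · subst hk; exact h1
  by_cases hk' : k = p + 1
  · subst hk'; exact h2
  exact (h k hk hk')

/-- both in `C`, first case -/
lemma dep_both1 {p : ℕ} {A : Finset ℕ} (hA : ind A (p + 1) ≤ ind A p) {C : Finset ℕ}
    (h1 : ind C p = 1) (h2 : ind C (p + 1) = 1) (h3 : qu A C p = 0 ∨ ind A p = 1) :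
    dep (sw p A) C = sw p (dep A C) := by
  have a1 := ind_le_one A p
  have a2 := ind_le_one A (p + 1)
  obtain ⟨hq, hk⟩ := dep_compare (p := p) (A := sw p A) (A' := A) (C := C) (C' := C)
    (fun k h h' => ind_sw_ne _ h h') (fun k _ _ => rfl) (by
      intro h; simp only [qu]; rw [ind_sw_left, ind_sw_right, h]; omega)
  apply ext_three (p := p)
  · intro k h h'; rw [ind_sw_ne _ h h', hk k h h']
  · rw [ind_sw_left, ind_dep, ind_dep]; simp only [qu]; rw [ind_sw_left, hq, h1, h2]
    omega
  · rw [ind_sw_right, ind_dep, ind_dep]; simp only [qu]; rw [ind_sw_left, ind_sw_right, hq, h1, h2]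
    omega

/-- both in `C`, second case -/
lemma dep_both2 {p : ℕ} {A : Finset ℕ} (hA : ind A (p + 1) ≤ ind A p) {C : Finset ℕ}
    (h1 : ind C p = 1) (h2 : ind C (p + 1) = 1)
    (h3 : ¬ (qu A C p = 0 ∧ ind A p = 1 ∧ ind A (p + 1) = 0)) :
    dep (sw p A) C = dep A C := by
  have a1 := ind_le_one A p
  have a2 := ind_le_one A (p + 1)
  obtain ⟨hq, hk⟩ := dep_compare (p := p) (A := sw p A) (A' := A) (C := C) (C' := C)
    (fun k h h' => ind_sw_ne _ h h') (fun k _ _ => rfl) (by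
      intro h; simp only [qu]; rw [ind_sw_left, ind_sw_right, h]; omega)
  apply ext_three (p := p) hk
  · rw [ind_dep, ind_dep, ind_sw_left, hq, h1]
    omega
  · rw [ind_dep, ind_dep]; simp only [qu]; rw [ind_sw_left, ind_sw_right, hq, h1, h2]
    omega

lemma ind_mono {A B : Finset ℕ} (h : A ⊆ B) (k : ℕ) : ind A k ≤ ind B k := by
  unfold ind; split_ifs with h1 h2
  · omega
  · exact absurd (h h1) h2
  · omega
  · omega

lemma qu_mono {A B : Finset ℕ} (h : A ⊆ B) (C : Finset ℕ) (k : ℕ) : qu A C k ≤ qu B C k := by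
  induction k with
  | zero => exact le_rfl
  | succ k ih => simp only [qu]; have := ind_mono h k; omega

lemma dep_mono {A B : Finset ℕ} (h : A ⊆ B) (C : Finset ℕ) : dep A C ⊆ dep B C := by
  intro k hk
  obtain ⟨h1, h2⟩ := Finset.mem_filter.1 hk
  refine Finset.mem_filter.2 ⟨h1, ?_⟩
  have := ind_mono h k
  have := qu_mono h C k
  omega

/-- `p ∉ C` -/
lemma dep_notleft {p : ℕ} (A : Finset ℕ) {C : Finset ℕ} (h1 : ind C p = 0) :
    dep (sw p A) C = dep A C := by
  have a1 := ind_le_one A p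
  have a2 := ind_le_one A (p + 1)
  obtain ⟨hq, hk⟩ := dep_compare (p := p) (A := sw p A) (A' := A) (C := C) (C' := C)
    (fun k h h' => ind_sw_ne _ h h') (fun k _ _ => rfl) (by
      intro h; simp only [qu]; rw [ind_sw_left, ind_sw_right, h]; omega)
  apply ext_three (p := p) hk
  · rw [ind_dep, ind_dep, h1]; simp
  · rw [ind_dep, ind_dep]; simp only [qu]; rw [ind_sw_left, ind_sw_right, hq, h1]
    rcases ind_cases C (p + 1) with h | h <;> rw [h] <;> omega

/-- `p ∈ C`, `p+1 ∉ C`. -/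
lemma dep_doublet {p : ℕ} {A : Finset ℕ} (hA : ind A (p + 1) ≤ ind A p) {C : Finset ℕ}
    (h1 : ind C p = 1) (h2 : ind C (p + 1) = 0) :
    dep A (sw p C) = sw p (dep A C) := by
  have a1 := ind_le_one A p
  have a2 := ind_le_one A (p + 1)
  obtain ⟨hq, hk⟩ := dep_compare (p := p) (A := A) (A' := A) (C := sw p C) (C' := C)
    (fun k _ _ => rfl) (fun k h h' => ind_sw_ne _ h h') (by
      intro h; simp only [qu]; rw [ind_sw_left, ind_sw_right, h]; omega)
  apply ext_three (p := p)
  · intro k h h'; rw [ind_sw_ne _ h h', hk k h h']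
  · rw [ind_sw_left, ind_dep, ind_dep]; simp only [qu]; rw [ind_sw_left, h2]
    simp
  · rw [ind_sw_right, ind_dep, ind_dep]; simp only [qu]; rw [ind_sw_left, ind_sw_right, hq, h1, h2]
    omega

lemma ind_dep_le {p : ℕ} {A : Finset ℕ} (hA : ind A (p + 1) ≤ ind A p) {C : Finset ℕ}
    (h1 : ind C (p + 1) ≤ ind C p) :
    ind (dep A C) (p + 1) ≤ ind (dep A C) p := by
  have a1 := ind_le_one A p
  have a2 := ind_le_one C p
  rw [ind_dep, ind_dep]; simp only [qu]
  rcases ind_cases C (p + 1) with h' | h'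
  · rw [h']; omega
  · rw [h', show ind C p = 1 by omega]; omega

lemma dep_subset (A C : Finset ℕ) : dep A C ⊆ C := Finset.filter_subset _ _

lemma pref_dep (A C : Finset ℕ) (k : ℕ) : pref (dep A C) k + qu A C k = pref A k := by
  induction k with
  | zero => simp [pref_zero, qu]
  | succ k ih =>
    rw [pref_succ, pref_succ, ind_dep]
    simp only [qu]
    rcases ind_cases C k with h | h <;> rw [h] <;> omega

lemma exists_bound (A B : Finset ℕ) : ∃ k, (∀ x ∈ A, x < k) ∧ ∀ x ∈ B, x < k := by
  refine ⟨(A ∪ B).sup id + 1, fun x hx => ?_, fun x hx => ?_⟩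
  · exact Nat.lt_succ_of_le (Finset.le_sup (f := id) (Finset.mem_union_left _ hx))
  · exact Nat.lt_succ_of_le (Finset.le_sup (f := id) (Finset.mem_union_right _ hx))

lemma card_dep_le (A C : Finset ℕ) : (dep A C).card ≤ A.card := by
  obtain ⟨k, h1, h2⟩ := exists_bound A (dep A C)
  rw [← pref_eq_card h1, ← pref_eq_card h2, ← pref_dep A C k]; omega

lemma pref_range (a k : ℕ) : pref (Finset.range a) k = min a k := by
  induction k with
  | zero => simp [pref_zero]
  | succ k ih =>
    rw [pref_succ, ih]; simp only [ind, Finset.mem_range]; split_ifs <;> omega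

lemma ext_pref {A B : Finset ℕ} (h : ∀ k, pref A k = pref B k) : A = B := by
  apply ext_ind
  intro k
  have h1 := h (k + 1)
  rw [pref_succ, pref_succ, h k] at h1
  omega

lemma pref_le (A : Finset ℕ) (k : ℕ) : pref A k ≤ k := by
  induction k with
  | zero => simp [pref_zero]
  | succ k ih => rw [pref_succ]; have := ind_le_one A k; omega

lemma Le_range {A : Finset ℕ} {a : ℕ} : Le A (Finset.range a) ↔ A = Finset.range a := by
  constructor
  · rintro ⟨h1, h2⟩
    apply ext_pref
    intro k
    have h3 := h2 k
    rw [pref_range] at h3 ⊢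
    have := pref_le A k
    have := pref_le_card A k
    rw [h1, Finset.card_range] at this
    omega
  · rintro rfl; exact ⟨rfl, fun _ => le_rfl⟩

/-- the extremal case of departures -/
lemma dep_eq_range {A : Finset ℕ} {a b : ℕ} (hab : a ≤ b) (hA : A.card ≤ a) :
    dep A (Finset.range b) = Finset.range a ↔ A = Finset.range a := by
  constructor
  · intro h
    rw [← Le_range]
    have h1 := card_dep_le A (Finset.range b)
    rw [h, Finset.card_range] at h1
    refine ⟨by rw [Finset.card_range]; omega, fun k => ?_⟩
    rw [← h, ← pref_dep A (Finset.range b) k]; omega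
  · rintro rfl
    have hq : ∀ k, qu (Finset.range a) (Finset.range b) k = 0 := by
      intro k
      induction k with
      | zero => rfl
      | succ k ih =>
        simp only [qu, ih, ind, Finset.mem_range]; split_ifs <;> omega
    apply ext_ind
    intro k
    rw [ind_dep, hq]
    simp only [ind, Finset.mem_range]
    split_ifs <;> simp <;> omega

end LSS

namespace LSS

/-- Exchange of `p` and `p+1` in all levels of a state. -/
def swS (p : ℕ) (τ : ℕ → Finset ℕ) : ℕ → Finset ℕ := fun r => sw p (τ r)

/-- Update of a state by a column. -/
def up (τ : ℕ → Finset ℕ) (C : Finset ℕ) : ℕ → Finset ℕ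
  | 0 => C
  | r + 1 => dep (τ r) C

/-- A column acting on a pair (state, weight). -/
def addC (C : Finset ℕ) (x : (ℕ → Finset ℕ) × (ℕ → ℕ)) : (ℕ → Finset ℕ) × (ℕ → ℕ) :=
  (up x.1 C, fun i => x.2 i + ind C i)

/-- Add a column of size `k` in all possible ways. -/
noncomputable def step (n k : ℕ) (M : Multiset ((ℕ → Finset ℕ) × (ℕ → ℕ))) :
    Multiset ((ℕ → Finset ℕ) × (ℕ → ℕ)) :=
  ∑ C ∈ Finset.powersetCard k (Finset.range n), M.map (addC C)

/-- Weight with prescribed entries at `p`, `p+1`. -/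
def WW (p : ℕ) (ν : ℕ → ℕ) (x y : ℕ) : ℕ → ℕ :=
  fun i => if i = p then x else if i = p + 1 then y else ν i

/-- A string. -/
def str (p : ℕ) (τ τ' : ℕ → Finset ℕ) (ν : ℕ → ℕ) (d L : ℕ) :
    Multiset ((ℕ → Finset ℕ) × (ℕ → ℕ)) :=
  (τ, WW p ν (d + L) d) ::ₘ
    (Multiset.range L).map (fun j => (τ', WW p ν (d + L - 1 - j) (d + 1 + j)))

/-- Admissible pairs of states along a string. -/
def GoodP (p : ℕ) (τ τ' : ℕ → Finset ℕ) : Prop :=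
  Antitone τ ∧ (∀ r, ind (τ r) (p + 1) ≤ ind (τ r) p) ∧ (τ' = τ ∨ τ' = swS p τ)

/-- Set of strings. -/
def Gen (p : ℕ) : Set (Multiset ((ℕ → Finset ℕ) × (ℕ → ℕ))) :=
  {M | ∃ τ τ' ν d L, GoodP p τ τ' ∧ M = str p τ τ' ν d L}

lemma up_antitone {τ : ℕ → Finset ℕ} (h : Antitone τ) (C : Finset ℕ) : Antitone (up τ C) := by
  apply antitone_nat_of_succ_le
  intro r
  cases r with
  | zero => exact dep_subset _ _
  | succ r => exact dep_mono (h (Nat.le_succ r)) C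

lemma swS_antitone {τ : ℕ → Finset ℕ} (h : Antitone τ) (p : ℕ) : Antitone (swS p τ) :=
  fun _ _ hab => Finset.image_subset_image (h hab)

lemma up_dom {p : ℕ} {τ : ℕ → Finset ℕ} (h : ∀ r, ind (τ r) (p + 1) ≤ ind (τ r) p)
    {C : Finset ℕ} (hC : ind C (p + 1) ≤ ind C p) (r : ℕ) :
    ind (up τ C r) (p + 1) ≤ ind (up τ C r) p := by
  cases r with
  | zero => exact hC
  | succ r => exact ind_dep_le (h r) hC

lemma sw_eq_self {p : ℕ} {C : Finset ℕ} (h : ind C p = ind C (p + 1)) : sw p C = C := by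
  apply ext_three (p := p)
  · intro k h1 h2; exact ind_sw_ne _ h1 h2
  · rw [ind_sw_left, h]
  · rw [ind_sw_right, h]

lemma up_singlet {p : ℕ} {τ τ' : ℕ → Finset ℕ} (h : GoodP p τ τ') {C : Finset ℕ}
    (hC : ind C p = ind C (p + 1)) : GoodP p (up τ C) (up τ' C) := by
  obtain ⟨ha, hd, rfl | rfl⟩ := h
  · exact ⟨up_antitone ha C, up_dom hd hC.ge, Or.inl rfl⟩
  · refine ⟨up_antitone ha C, up_dom hd hC.ge, ?_⟩
    rcases ind_cases C p with h0 | h1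
    · left
      funext r
      cases r with
      | zero => rfl
      | succ r => exact dep_notleft _ h0
    · by_cases hex : ∃ r, qu (τ r) C p = 0 ∧ ind (τ r) p = 1 ∧ ind (τ r) (p + 1) = 0
      · right
        obtain ⟨r₀, e1, e2, e3⟩ := hex
        funext r
        cases r with
        | zero => exact (sw_eq_self hC).symm
        | succ r =>
          apply dep_both1 (hd r) h1 (hC ▸ h1)
          rcases le_total r₀ r with hr | hr
          · left
            have := qu_mono (ha hr) C p
            omega
          · right
            have := ind_mono (ha hr) p
            have := ind_le_one (τ r) p
            omega
      · left
        funext r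
        cases r with
        | zero => rfl
        | succ r => exact dep_both2 (hd r) h1 (hC ▸ h1) (fun hh => hex ⟨r, hh⟩)

lemma up_doublet {p : ℕ} {τ τ' : ℕ → Finset ℕ} (h : GoodP p τ τ') {C : Finset ℕ}
    (h1 : ind C p = 1) (h2 : ind C (p + 1) = 0) :
    GoodP p (up τ C) (swS p (up τ C)) ∧ GoodP p (up τ' C) (up τ' C) ∧
    up τ (sw p C) = swS p (up τ C) ∧ up τ' (sw p C) = swS p (up τ C) := by
  have hc : ∀ ρ r, ind (up ρ C r) (p + 1) ≤ ind (up ρ C r) p := by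
    intro ρ r
    have : ind (up ρ C r) (p + 1) ≤ ind C (p + 1) := by
      cases r with
      | zero => exact le_rfl
      | succ r => exact ind_mono (dep_subset _ _) _
    omega
  obtain ⟨ha, hd, ht⟩ := h
  have ha' : Antitone τ' := by
    rcases ht with rfl | rfl
    · exact ha
    · exact swS_antitone ha p
  have e1 : up τ (sw p C) = swS p (up τ C) := by
    funext r
    cases r with
    | zero => rfl
    | succ r => exact dep_doublet (hd r) h1 h2
  refine ⟨⟨up_antitone ha C, hc τ, Or.inr rfl⟩, ⟨up_antitone ha' C, hc τ', Or.inl rfl⟩, e1, ?_⟩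
  rcases ht with rfl | rfl
  · exact e1
  · rw [← e1]
    funext r
    cases r with
    | zero => rfl
    | succ r => exact dep_notleft _ (by rw [ind_sw_left, h2])

lemma WW_add (p : ℕ) (ν : ℕ → ℕ) (x y : ℕ) (C : Finset ℕ) :
    (fun i => WW p ν x y i + ind C i) =
      WW p (fun i => ν i + ind C i) (x + ind C p) (y + ind C (p + 1)) := by
  funext i
  unfold WW
  by_cases h1 : i = p
  · simp [h1]
  · by_cases h2 : i = p + 1 <;> simp [h1, h2]

lemma WW_congr {p : ℕ} {ν ν' : ℕ → ℕ} (h : ∀ i, i ≠ p → i ≠ p + 1 → ν i = ν' i) {x x' y y' : ℕ}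
    (hx : x = x') (hy : y = y') : WW p ν x y = WW p ν' x' y' := by
  subst hx hy
  funext i
  unfold WW
  split_ifs with h1 h2
  · rfl
  · rfl
  · exact h i h1 h2

lemma map_singlet {p : ℕ} (τ τ' : ℕ → Finset ℕ) (ν : ℕ → ℕ) (d L : ℕ) {C : Finset ℕ}
    (hC : ind C p = ind C (p + 1)) :
    (str p τ τ' ν d L).map (addC C) =
      str p (up τ C) (up τ' C) (fun i => ν i + ind C i) (d + ind C p) L := by
  unfold str
  rw [Multiset.map_cons, Multiset.map_map]
  congr 1
  · unfold addC
    rw [WW_add]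
    exact Prod.ext rfl (WW_congr (fun _ _ _ => rfl) (by omega) (by omega))
  · apply Multiset.map_congr rfl
    intro j hj
    rw [Multiset.mem_range] at hj
    simp only [Function.comp, addC]
    rw [WW_add]
    exact Prod.ext rfl (WW_congr (fun _ _ _ => rfl) (by omega) (by omega))

lemma range_succ_map {X : Type*} (f : ℕ → X) (L : ℕ) :
    (Multiset.range (L + 1)).map f = f 0 ::ₘ (Multiset.range L).map (fun j => f (j + 1)) := by
  induction L with
  | zero => rfl
  | succ L ih =>
    rw [Multiset.range_succ, Multiset.map_cons, ih, Multiset.range_succ L, Multiset.map_cons,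
      Multiset.cons_swap]

lemma map_doublet_right {p : ℕ} {τ τ' σ : ℕ → Finset ℕ} (ν : ℕ → ℕ) (d L : ℕ) {C : Finset ℕ}
    (h1 : ind C p = 1) (h2 : ind C (p + 1) = 0)
    (e1 : up τ (sw p C) = σ) (e2 : up τ' (sw p C) = σ) :
    (str p τ τ' ν d L).map (addC (sw p C)) =
      (Multiset.range (L + 1)).map
        (fun j => (σ, WW p (fun i => ν i + ind C i) (d + (L + 1) - 1 - j) (d + 1 + j))) := by
  unfold str
  rw [Multiset.map_cons, Multiset.map_map, range_succ_map]
  congr 1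
  · unfold addC
    rw [WW_add, ind_sw_left, ind_sw_right, h1, h2, e1]
    exact Prod.ext rfl (WW_congr (fun i hi hi' => by rw [ind_sw_ne _ hi hi']) (by omega) (by omega))
  · apply Multiset.map_congr rfl
    intro j hj
    rw [Multiset.mem_range] at hj
    simp only [Function.comp, addC]
    rw [WW_add, ind_sw_left, ind_sw_right, h1, h2, e2]
    exact Prod.ext rfl (WW_congr (fun i hi hi' => by rw [ind_sw_ne _ hi hi']) (by omega) (by omega))

lemma map_doublet_left {p : ℕ} (τ τ' : ℕ → Finset ℕ) (ν : ℕ → ℕ) (d L : ℕ) {C : Finset ℕ}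
    (h1 : ind C p = 1) (h2 : ind C (p + 1) = 0) :
    (str p τ τ' ν d L).map (addC C) =
      (up τ C, WW p (fun i => ν i + ind C i) (d + (L + 1)) d) ::ₘ (Multiset.range L).map
        (fun j => (up τ' C, WW p (fun i => ν i + ind C i) (d + L - j) (d + 1 + j))) := by
  unfold str
  rw [Multiset.map_cons, Multiset.map_map]
  congr 1
  · unfold addC
    rw [WW_add, h1, h2]
    exact Prod.ext rfl (WW_congr (fun i hi hi' => rfl) (by omega) (by omega))
  · apply Multiset.map_congr rfl
    intro j hj
    rw [Multiset.mem_range] at hj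
    simp only [Function.comp, addC]
    rw [WW_add, h1, h2]
    exact Prod.ext rfl (WW_congr (fun i hi hi' => rfl) (by omega) (by omega))

lemma doublet_mem {p : ℕ} {τ τ' : ℕ → Finset ℕ} (h : GoodP p τ τ') (ν : ℕ → ℕ) (d L : ℕ)
    {C : Finset ℕ} (h1 : ind C p = 1) (h2 : ind C (p + 1) = 0) :
    (str p τ τ' ν d L).map (addC C) + (str p τ τ' ν d L).map (addC (sw p C)) ∈
      AddSubmonoid.closure (Gen p) := by
  obtain ⟨g1, g2, e1, e2⟩ := up_doublet h h1 h2
  rw [map_doublet_right ν d L h1 h2 e1 e2, map_doublet_left τ τ' ν d L h1 h2, Multiset.cons_add,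
    add_comm (Multiset.map _ (Multiset.range L)) _, ← Multiset.cons_add]
  refine add_mem (AddSubmonoid.subset_closure ⟨_, _, _, d, L + 1, g1, rfl⟩) ?_
  cases L with
  | zero => exact zero_mem _
  | succ L =>
    refine AddSubmonoid.subset_closure ⟨_, _, (fun i => ν i + ind C i), d + 1, L, g2, ?_⟩
    rw [range_succ_map]
    unfold str
    congr 1
    · exact Prod.ext rfl (WW_congr (fun i hi hi' => rfl) (by omega) (by omega))
    · apply Multiset.map_congr rfl
      intro j hj
      exact Prod.ext rfl (WW_congr (fun i hi hi' => rfl) (by omega) (by omega))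

lemma step_add (n k : ℕ) (M N : Multiset ((ℕ → Finset ℕ) × (ℕ → ℕ))) :
    step n k (M + N) = step n k M + step n k N := by
  simp [step, Finset.sum_add_distrib]

lemma sw_mem_cols {n k p : ℕ} (hp : p + 1 < n) {C : Finset ℕ}
    (hC : C ∈ Finset.powersetCard k (Finset.range n)) :
    sw p C ∈ Finset.powersetCard k (Finset.range n) := by
  rw [Finset.mem_powersetCard] at hC ⊢
  refine ⟨fun x hx => ?_, by rw [card_sw]; exact hC.2⟩
  rw [mem_sw] at hx
  have h1 := hC.1 hx
  rw [Finset.mem_range] at h1 ⊢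
  by_cases hx1 : x = p
  · omega
  by_cases hx2 : x = p + 1
  · omega
  rwa [Equiv.swap_apply_of_ne_of_ne hx1 hx2] at h1

lemma step_gen {n k p : ℕ} (hp : p + 1 < n) {M : Multiset ((ℕ → Finset ℕ) × (ℕ → ℕ))}
    (hM : M ∈ Gen p) : step n k M ∈ AddSubmonoid.closure (Gen p) := by
  obtain ⟨τ, τ', ν, d, L, hg, rfl⟩ := hM
  unfold step
  set 𝒞 := Finset.powersetCard k (Finset.range n) with h𝒞
  rw [← Finset.sum_filter_add_sum_filter_not 𝒞 (fun C => ind C p = ind C (p + 1))]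
  refine add_mem (sum_mem fun C hC => ?_) ?_
  · rw [map_singlet _ _ _ _ _ (Finset.mem_filter.1 hC).2]
    exact AddSubmonoid.subset_closure ⟨_, _, _, _, _, up_singlet hg (Finset.mem_filter.1 hC).2, rfl⟩
  · rw [← Finset.sum_filter_add_sum_filter_not (𝒞.filter fun C => ¬ ind C p = ind C (p + 1))
      (fun C => ind C p = 1)]
    have : ∑ C ∈ (𝒞.filter fun C => ¬ ind C p = ind C (p + 1)).filter (fun C => ¬ ind C p = 1),
        (str p τ τ' ν d L).map (addC C) =
        ∑ C ∈ (𝒞.filter fun C => ¬ ind C p = ind C (p + 1)).filter (fun C => ind C p = 1),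
        (str p τ τ' ν d L).map (addC (sw p C)) := by
      refine Finset.sum_bij' (fun C _ => sw p C) (fun C _ => sw p C) ?_ ?_ ?_ ?_ ?_
      · intro C hC
        simp only [Finset.mem_filter] at hC ⊢
        refine ⟨⟨sw_mem_cols hp hC.1.1, ?_⟩, ?_⟩
        · rw [ind_sw_left, ind_sw_right]; exact fun h => hC.1.2 h.symm
        · rw [ind_sw_left]
          have := ind_cases C p
          have := ind_cases C (p + 1)
          omega
      · intro C hC
        simp only [Finset.mem_filter] at hC ⊢
        refine ⟨⟨sw_mem_cols hp hC.1.1, ?_⟩, ?_⟩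
        · rw [ind_sw_left, ind_sw_right]; exact fun h => hC.1.2 h.symm
        · rw [ind_sw_left]
          have := ind_cases C p
          have := ind_cases C (p + 1)
          omega
      · intro C _; exact sw_sw p C
      · intro C _; exact sw_sw p C
      · intro C _; simp only [sw_sw]
    rw [this, ← Finset.sum_add_distrib]
    refine sum_mem fun C hC => ?_
    simp only [Finset.mem_filter] at hC
    apply doublet_mem hg _ _ _ hC.2
    have := ind_cases C (p + 1)
    omega

lemma step_closure {n k p : ℕ} (hp : p + 1 < n) {M : Multiset ((ℕ → Finset ℕ) × (ℕ → ℕ))}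
    (hM : M ∈ AddSubmonoid.closure (Gen p)) : step n k M ∈ AddSubmonoid.closure (Gen p) := by
  induction hM using AddSubmonoid.closure_induction with
  | mem x hx => exact step_gen hp hx
  | zero =>
    have : step n k 0 = 0 := by simp [step]
    rw [this]; exact zero_mem _
  | add x y _ _ hx hy => rw [step_add]; exact add_mem hx hy

/-- All sequences of columns of sizes `k (m-1), …, k 0`. -/
noncomputable def FF (n : ℕ) : ℕ → (ℕ → ℕ) → Multiset ((ℕ → Finset ℕ) × (ℕ → ℕ))
  | 0, _ => {(fun _ => ∅, fun _ => 0)}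
  | m + 1, k => step n (k 0) (FF n m (fun r => k (r + 1)))

lemma FF_closure {n p : ℕ} (hp : p + 1 < n) (m : ℕ) (k : ℕ → ℕ) :
    FF n m k ∈ AddSubmonoid.closure (Gen p) := by
  induction m generalizing k with
  | zero =>
    refine AddSubmonoid.subset_closure ⟨fun _ => ∅, fun _ => ∅, fun _ => 0, 0, 0,
      ⟨fun _ _ _ => le_rfl, fun r => by simp [ind], Or.inl rfl⟩, ?_⟩
    simp only [FF, str]
    have : WW p (fun _ => 0) (0 + 0) 0 = fun _ => 0 := by
      funext i; unfold WW; split_ifs <;> rfl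
    rw [this]
    rfl
  | succ m ih => exact step_closure hp (ih _)

end LSS

namespace LSS

open MvPolynomial

/-- Monomial of a weight on `ℕ`. -/
noncomputable def mw (n : ℕ) (μ : ℕ → ℕ) : MvPolynomial (Fin n) ℤ := mono n (fun i => μ i.1)

/-- Partial character. -/
noncomputable def ch (n : ℕ) (S : Set (ℕ → Finset ℕ))
    (M : Multiset ((ℕ → Finset ℕ) × (ℕ → ℕ))) : MvPolynomial (Fin n) ℤ :=
  (M.map (fun x => if x.1 ∈ S then mw n x.2 else 0)).sum

lemma ch_add (n : ℕ) (S : Set (ℕ → Finset ℕ)) (M N : Multiset ((ℕ → Finset ℕ) × (ℕ → ℕ))) :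
    ch n S (M + N) = ch n S M + ch n S N := by
  simp [ch]

lemma ch_zero (n : ℕ) (S : Set (ℕ → Finset ℕ)) : ch n S 0 = 0 := by simp [ch]

lemma expOf_apply (n : ℕ) (β : Fin n → ℕ) (i : Fin n) : expOf n β i = β i := rfl

lemma expOf_inj {n : ℕ} {β γ : Fin n → ℕ} : expOf n β = expOf n γ ↔ β = γ :=
  Finsupp.equivFunOnFinite.symm.injective.eq_iff

lemma coeffOf_mono (n : ℕ) (β γ : Fin n → ℕ) :
    coeffOf n β (mono n γ) = if γ = β then 1 else 0 := by
  unfold coeffOf mono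
  rw [coeff_monomial]
  simp only [expOf_inj]

lemma X_mul_mono {n : ℕ} (P : Fin n) (γ γ' : Fin n → ℕ) (h1 : γ' P = γ P + 1)
    (h2 : ∀ i, i ≠ P → γ' i = γ i) : X P * mono n γ = mono n γ' := by
  unfold mono X
  rw [monomial_mul, one_mul]
  refine congrArg (fun q => monomial q (1 : ℤ)) ?_
  ext i
  rw [Finsupp.add_apply, expOf_apply, expOf_apply]
  by_cases h : i = P
  · subst h; simp [h1]; omega
  · rw [h2 i h, Finsupp.single_eq_of_ne h, zero_add]

lemma rename_mono {n : ℕ} (e : Equiv.Perm (Fin n)) (γ : Fin n → ℕ) :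
    rename (⇑e) (mono n γ) = mono n (fun i => γ (e.symm i)) := by
  unfold mono
  rw [rename_monomial]
  refine congrArg (fun q => monomial q (1 : ℤ)) ?_
  ext i
  rw [expOf_apply, ← Finsupp.equivMapDomain_eq_mapDomain]
  rfl

/-- Partial string polynomial. -/
noncomputable def strf (n p : ℕ) (ν : ℕ → ℕ) (d L K : ℕ) : MvPolynomial (Fin n) ℤ :=
  ∑ j ∈ Finset.range (K + 1), mw n (WW p ν (d + L - j) (d + j))

/-- The defining relation of `π_{p+1}`. -/
def IsDem {n p : ℕ} (hp : p + 1 < n) (f g : MvPolynomial (Fin n) ℤ) : Prop :=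
  (X (⟨p, by omega⟩ : Fin n) - X (⟨p + 1, hp⟩ : Fin n)) * g =
    X (⟨p, by omega⟩ : Fin n) * f - X (⟨p + 1, hp⟩ : Fin n) *
      rename (⇑(Equiv.swap (⟨p, by omega⟩ : Fin n) (⟨p + 1, hp⟩ : Fin n))) f

lemma X_mul_left {n p : ℕ} (hp : p + 1 < n) (ν : ℕ → ℕ) (x y : ℕ) :
    X (⟨p, by omega⟩ : Fin n) * mw n (WW p ν x y) = mw n (WW p ν (x + 1) y) := by
  apply X_mul_mono
  · simp [WW]
  · intro i hi
    have : i.1 ≠ p := fun h => hi (Fin.ext h)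
    simp [WW, this]

lemma X_mul_right {n p : ℕ} (hp : p + 1 < n) (ν : ℕ → ℕ) (x y : ℕ) :
    X (⟨p + 1, hp⟩ : Fin n) * mw n (WW p ν x y) = mw n (WW p ν x (y + 1)) := by
  apply X_mul_mono
  · simp [WW]
  · intro i hi
    have : i.1 ≠ p + 1 := fun h => hi (Fin.ext h)
    simp [WW, this]

lemma rename_WW {n p : ℕ} (hp : p + 1 < n) (ν : ℕ → ℕ) (x y : ℕ) :
    rename (⇑(Equiv.swap (⟨p, by omega⟩ : Fin n) (⟨p + 1, hp⟩ : Fin n))) (mw n (WW p ν x y)) =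
      mw n (WW p ν y x) := by
  unfold mw
  rw [rename_mono]
  congr 1
  funext i
  rw [Equiv.symm_swap]
  by_cases h1 : i = ⟨p, by omega⟩
  · rw [h1, Equiv.swap_apply_left]; simp [WW]
  by_cases h2 : i = ⟨p + 1, hp⟩
  · rw [h2, Equiv.swap_apply_right]; simp [WW]
  rw [Equiv.swap_apply_of_ne_of_ne h1 h2]
  have h1' : i.1 ≠ p := fun h => h1 (Fin.ext h)
  have h2' : i.1 ≠ p + 1 := fun h => h2 (Fin.ext h)
  simp [WW, h1', h2']

lemma isDem_top {n p : ℕ} (hp : p + 1 < n) (ν : ℕ → ℕ) (d L : ℕ) :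
    IsDem hp (strf n p ν d L 0) (strf n p ν d L L) := by
  unfold IsDem strf
  rw [zero_add, Finset.sum_range_one, rename_WW, X_mul_left hp, X_mul_right hp, sub_mul,
    Finset.mul_sum, Finset.mul_sum, ← Finset.sum_sub_distrib]
  have : ∀ j ∈ Finset.range (L + 1),
      X (⟨p, by omega⟩ : Fin n) * mw n (WW p ν (d + L - j) (d + j)) -
      X (⟨p + 1, hp⟩ : Fin n) * mw n (WW p ν (d + L - j) (d + j)) =
      (fun j => mw n (WW p ν (d + L + 1 - j) (d + j))) j -
      (fun j => mw n (WW p ν (d + L + 1 - j) (d + j))) (j + 1) := by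
    intro j hj
    rw [Finset.mem_range] at hj
    rw [X_mul_left hp, X_mul_right hp]
    simp only
    rw [show d + L + 1 - j = d + L - j + 1 by omega,
      show d + L + 1 - (j + 1) = d + L - j by omega, show d + (j + 1) = d + j + 1 by omega]
  rw [Finset.sum_congr rfl this, Finset.sum_range_sub']
  simp only [Nat.sub_zero, add_zero]
  rw [show d + L + 1 - (L + 1) = d by omega]
  rfl

lemma isDem_full {n p : ℕ} (hp : p + 1 < n) (ν : ℕ → ℕ) (d L : ℕ) :
    IsDem hp (strf n p ν d L L) (strf n p ν d L L) := by
  unfold IsDem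
  have : rename (⇑(Equiv.swap (⟨p, by omega⟩ : Fin n) (⟨p + 1, hp⟩ : Fin n)))
      (strf n p ν d L L) = strf n p ν d L L := by
    unfold strf
    rw [map_sum, ← Finset.sum_range_reflect]
    apply Finset.sum_congr rfl
    intro j hj
    rw [Finset.mem_range] at hj
    rw [rename_WW, show d + (L + 1 - 1 - j) = d + L - j by omega,
      show d + L - (L + 1 - 1 - j) = d + j by omega]
  rw [this, sub_mul]

/-- The second weight lies in the string below the first. -/
def Spread {n : ℕ} (P Q : Fin n) (β' β : Fin n → ℕ) : Prop :=
  (∀ i, i ≠ P → i ≠ Q → β' i = β i) ∧ β' P + β' Q = β P + β Q ∧ β P ≤ β' P ∧ β Q ≤ β' P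

/-- Compatible pairs of polynomials. -/
def GoodPair {n p : ℕ} (hp : p + 1 < n) (f g : MvPolynomial (Fin n) ℤ) : Prop :=
  IsDem hp f g ∧ (∀ β, 0 ≤ coeffOf n β f) ∧ (∀ β, 0 ≤ coeffOf n β g) ∧
  ∀ β, 0 < coeffOf n β g ↔
    ∃ β', Spread (⟨p, by omega⟩ : Fin n) ⟨p + 1, hp⟩ β' β ∧ 0 < coeffOf n β' f

lemma coeffOf_add (n : ℕ) (β : Fin n → ℕ) (f g : MvPolynomial (Fin n) ℤ) :
    coeffOf n β (f + g) = coeffOf n β f + coeffOf n β g := coeff_add _ _ _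

lemma coeffOf_zero (n : ℕ) (β : Fin n → ℕ) : coeffOf n β 0 = 0 := coeff_zero _

lemma GoodPair_zero {n p : ℕ} (hp : p + 1 < n) : GoodPair hp 0 0 := by
  refine ⟨by simp [IsDem], ?_, ?_, ?_⟩ <;> simp [coeffOf_zero]

lemma GoodPair_add {n p : ℕ} (hp : p + 1 < n) {f g f' g' : MvPolynomial (Fin n) ℤ}
    (h : GoodPair hp f g) (h' : GoodPair hp f' g') : GoodPair hp (f + f') (g + g') := by
  obtain ⟨a1, a2, a3, a4⟩ := h
  obtain ⟨b1, b2, b3, b4⟩ := h'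
  refine ⟨?_, ?_, ?_, ?_⟩
  · unfold IsDem at *
    rw [mul_add, a1, b1, map_add]; ring
  · intro β; rw [coeffOf_add]; exact add_nonneg (a2 β) (b2 β)
  · intro β; rw [coeffOf_add]; exact add_nonneg (a3 β) (b3 β)
  · intro β
    have key : 0 < coeffOf n β g + coeffOf n β g' ↔
        (0 < coeffOf n β g ∨ 0 < coeffOf n β g') := by
      have := a3 β; have := b3 β; omega
    rw [coeffOf_add, key, a4, b4]
    constructor
    · rintro (⟨β', h1, h2⟩ | ⟨β', h1, h2⟩)
      · exact ⟨β', h1, by rw [coeffOf_add]; have := b2 β'; omega⟩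
      · exact ⟨β', h1, by rw [coeffOf_add]; have := a2 β'; omega⟩
    · rintro ⟨β', h1, h2⟩
      rw [coeffOf_add] at h2
      have := a2 β'
      have := b2 β'
      by_cases h3 : 0 < coeffOf n β' f
      · exact Or.inl ⟨β', h1, h3⟩
      · exact Or.inr ⟨β', h1, by omega⟩

lemma coeffOf_sum {ι : Type*} (n : ℕ) (β : Fin n → ℕ) (s : Finset ι)
    (f : ι → MvPolynomial (Fin n) ℤ) :
    coeffOf n β (∑ j ∈ s, f j) = ∑ j ∈ s, coeffOf n β (f j) := coeff_sum _ _ _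

lemma strf_nonneg (n p : ℕ) (ν : ℕ → ℕ) (d L K : ℕ) (β : Fin n → ℕ) :
    0 ≤ coeffOf n β (strf n p ν d L K) := by
  unfold strf
  rw [coeffOf_sum]
  refine Finset.sum_nonneg fun j _ => ?_
  unfold mw
  rw [coeffOf_mono]
  split_ifs <;> norm_num

lemma strf_pos (n p : ℕ) (ν : ℕ → ℕ) (d L K : ℕ) (β : Fin n → ℕ) :
    0 < coeffOf n β (strf n p ν d L K) ↔
      ∃ j ≤ K, ∀ i : Fin n, WW p ν (d + L - j) (d + j) i = β i := by
  unfold strf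
  rw [coeffOf_sum, Finset.sum_pos_iff_of_nonneg]
  · simp only [mw, coeffOf_mono, Finset.mem_range, funext_iff]
    constructor
    · rintro ⟨j, h1, h2⟩
      refine ⟨j, by omega, ?_⟩
      by_contra h
      simp [h] at h2
    · rintro ⟨j, h1, h2⟩
      exact ⟨j, by omega, by rw [if_pos h2]; norm_num⟩
  · intro j _
    unfold mw
    rw [coeffOf_mono]
    split_ifs <;> norm_num

lemma GoodPair_str {n p : ℕ} (hp : p + 1 < n) (ν : ℕ → ℕ) (d L K : ℕ) (hK : K = 0 ∨ K = L) :
    GoodPair hp (strf n p ν d L K) (strf n p ν d L L) := by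
  refine ⟨?_, strf_nonneg _ _ _ _ _ _, strf_nonneg _ _ _ _ _ _, ?_⟩
  · rcases hK with rfl | rfl
    · exact isDem_top hp ν d L
    · exact isDem_full hp ν d _
  · intro β
    rw [strf_pos]
    constructor
    · rintro ⟨j, hj, h⟩
      refine ⟨fun i => WW p ν (d + L) d i.1, ⟨?_, ?_, ?_, ?_⟩, ?_⟩
      · intro i h1 h2
        have h1' : i.1 ≠ p := fun h => h1 (Fin.ext h)
        have h2' : i.1 ≠ p + 1 := fun h => h2 (Fin.ext h)
        rw [← h i]; simp [WW, h1', h2']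
      · rw [← h, ← h]; simp [WW]; omega
      · rw [← h]; simp [WW]
      · rw [← h]; simp [WW]; omega
      · rw [strf_pos]; exact ⟨0, by omega, fun i => by simp⟩
    · rintro ⟨β', ⟨h1, h2, h3, h4⟩, h5⟩
      rw [strf_pos] at h5
      obtain ⟨j, hj, h⟩ := h5
      have e1 := h ⟨p, by omega⟩
      have e2 := h ⟨p + 1, hp⟩
      simp only [WW, if_true, Nat.succ_ne_self, if_false] at e1 e2
      refine ⟨β ⟨p + 1, hp⟩ - d, by omega, ?_⟩
      intro i
      unfold WW
      split_ifs with q1 q2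
      · have : i = ⟨p, by omega⟩ := Fin.ext q1
        rw [this]; omega
      · have : i = ⟨p + 1, hp⟩ := Fin.ext q2
        rw [this]; omega
      · rw [← h1 i (fun hh => q1 (by rw [hh])) (fun hh => q2 (by rw [hh])), ← h i]
        simp [WW, q1, q2]

lemma ch_str_sum (n p : ℕ) (S : Set (ℕ → Finset ℕ)) (τ τ' : ℕ → Finset ℕ) (ν : ℕ → ℕ) (d L : ℕ) :
    ch n S (str p τ τ' ν d L) = (if τ ∈ S then mw n (WW p ν (d + L) d) else 0) +
      ∑ j ∈ Finset.range L, if τ' ∈ S then mw n (WW p ν (d + L - (j + 1)) (d + (j + 1))) else 0 := by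
  unfold ch str
  rw [Multiset.map_cons, Multiset.sum_cons, Multiset.map_map]
  congr 1
  change (Multiset.map _ (Finset.range L).val).sum = _
  apply Finset.sum_congr rfl
  intro j _
  simp only [Function.comp]
  rw [show d + L - 1 - j = d + L - (j + 1) by omega, show d + 1 + j = d + (j + 1) by omega]

lemma ch_str_full {n p : ℕ} {S : Set (ℕ → Finset ℕ)} {τ τ' : ℕ → Finset ℕ} (ν : ℕ → ℕ) (d L : ℕ)
    (h : τ ∈ S) (h' : τ' ∈ S) : ch n S (str p τ τ' ν d L) = strf n p ν d L L := by
  rw [ch_str_sum, strf, Finset.sum_range_succ', if_pos h, add_comm]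
  simp [h']

lemma ch_str_top {n p : ℕ} {S : Set (ℕ → Finset ℕ)} {τ τ' : ℕ → Finset ℕ} (ν : ℕ → ℕ) (d L : ℕ)
    (h : τ ∈ S) (h' : τ' ∉ S) : ch n S (str p τ τ' ν d L) = strf n p ν d L 0 := by
  rw [ch_str_sum, strf, if_pos h]
  simp [h']

lemma ch_str_none {n p : ℕ} {S : Set (ℕ → Finset ℕ)} {τ τ' : ℕ → Finset ℕ} (ν : ℕ → ℕ) (d L : ℕ)
    (h : τ ∉ S) (h' : τ' ∉ S) : ch n S (str p τ τ' ν d L) = 0 := by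
  rw [ch_str_sum, if_neg h]
  rw [Finset.sum_eq_zero (fun j _ => if_neg h'), add_zero]

/-- States below a given family. -/
def SS (a : ℕ → Finset ℕ) : Set (ℕ → Finset ℕ) := {A | ∀ r, Le (A r) (a r)}

lemma GoodPair_gen {n p : ℕ} (hp : p + 1 < n) {a : ℕ → Finset ℕ}
    (ha : ∀ r, ind (a r) p ≤ ind (a r) (p + 1)) {M : Multiset ((ℕ → Finset ℕ) × (ℕ → ℕ))}
    (hM : M ∈ Gen p) : GoodPair hp (ch n (SS (swS p a)) M) (ch n (SS a) M) := by
  obtain ⟨τ, τ', ν, d, L, ⟨-, hd, ht⟩, rfl⟩ := hM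
  have k1 : τ ∈ SS (swS p a) ↔ τ ∈ SS a := forall_congr' fun r => (Le_lift (hd r) (ha r)).1
  have k2 : τ' ∈ SS a ↔ τ ∈ SS a := by
    rcases ht with rfl | rfl
    · rfl
    · exact forall_congr' fun r => (Le_lift (hd r) (ha r)).2
  have k3 : τ' ∈ SS (swS p a) → τ ∈ SS (swS p a) := by
    rcases ht with rfl | rfl
    · exact id
    · exact fun h r => Le_unsw (hd r) (h r)
  by_cases h : τ ∈ SS a
  · rw [ch_str_full (S := SS a) ν d L h (k2.2 h)]
    by_cases h' : τ' ∈ SS (swS p a)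
    · rw [ch_str_full ν d L (k1.2 h) h']
      exact GoodPair_str hp ν d L L (Or.inr rfl)
    · rw [ch_str_top ν d L (k1.2 h) h']
      exact GoodPair_str hp ν d L 0 (Or.inl rfl)
  · rw [ch_str_none (S := SS a) ν d L h (fun hh => h (k2.1 hh)),
      ch_str_none ν d L (fun hh => h (k1.1 hh)) (fun hh => h (k1.1 (k3 hh)))]
    exact GoodPair_zero hp

lemma GoodPair_FF {n p : ℕ} (hp : p + 1 < n) {a : ℕ → Finset ℕ}
    (ha : ∀ r, ind (a r) p ≤ ind (a r) (p + 1)) (m : ℕ) (k : ℕ → ℕ) :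
    GoodPair hp (ch n (SS (swS p a)) (FF n m k)) (ch n (SS a) (FF n m k)) := by
  have h := FF_closure hp m k
  generalize FF n m k = M at h
  induction h using AddSubmonoid.closure_induction with
  | mem x hx => exact GoodPair_gen hp ha hx
  | zero => rw [ch_zero, ch_zero]; exact GoodPair_zero hp
  | add x y _ _ hx hy => rw [ch_add, ch_add]; exact GoodPair_add hp hx hy

lemma dem_eq {n p : ℕ} (hp : p + 1 < n) {f g : MvPolynomial (Fin n) ℤ} (h : IsDem hp f g) :
    dem n (p + 1) f = g := by
  unfold dem
  have h0 : 0 < p + 1 ∧ p + 1 < n := ⟨by omega, hp⟩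
  rw [dif_pos h0]
  have hex : ∃ g, (X (⟨p + 1 - 1, by omega⟩ : Fin n) - X (⟨p + 1, h0.2⟩ : Fin n)) * g =
        X (⟨p + 1 - 1, by omega⟩ : Fin n) * f -
          X (⟨p + 1, h0.2⟩ : Fin n) *
            rename (⇑(Equiv.swap (⟨p + 1 - 1, by omega⟩ : Fin n) (⟨p + 1, h0.2⟩ : Fin n))) f :=
    ⟨g, h⟩
  rw [dif_pos hex]
  have h1 := hex.choose_spec
  have h2 : (X (⟨p, by omega⟩ : Fin n) - X (⟨p + 1, hp⟩ : Fin n) : MvPolynomial (Fin n) ℤ) ≠ 0 := by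
    rw [sub_ne_zero]
    intro hh
    have := X_injective hh
    simp at this
  exact mul_left_cancel₀ h2 (h1.trans h.symm)

end LSS

namespace LSS

open MvPolynomial

/-- Level sets of a composition. -/
noncomputable def lev (n : ℕ) (α : Fin n → ℕ) (r : ℕ) : Finset ℕ :=
  (Finset.range n).filter fun i => r < ent n α i

lemma mem_lev {n : ℕ} {α : Fin n → ℕ} {r i : ℕ} : i ∈ lev n α r ↔ r < ent n α i := by
  unfold lev
  rw [Finset.mem_filter, Finset.mem_range]
  constructor
  · exact fun h => h.2
  · intro h
    refine ⟨?_, h⟩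
    by_contra hn
    simp [ent, hn] at h

lemma ent_val {n : ℕ} (α : Fin n → ℕ) (i : Fin n) : ent n α i.1 = α i := by
  simp [ent]

lemma ent_swapAt {n p : ℕ} (hp : p + 1 < n) (α : Fin n → ℕ) (x : ℕ) :
    ent n (swapAt n p α) x = ent n α (Equiv.swap p (p + 1) x) := by
  by_cases h1 : x = p
  · subst h1
    rw [Equiv.swap_apply_left]
    conv_lhs => unfold ent
    rw [dif_pos (by omega)]
    simp [swapAt]
  by_cases h2 : x = p + 1
  · subst h2
    rw [Equiv.swap_apply_right]
    conv_lhs => unfold ent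
    rw [dif_pos (by omega)]
    simp [swapAt]
  rw [Equiv.swap_apply_of_ne_of_ne h1 h2]
  unfold ent
  by_cases h : x < n
  · simp [h, swapAt, h1, h2]
  · simp [h]

lemma lev_swapAt {n p : ℕ} (hp : p + 1 < n) (α : Fin n → ℕ) :
    lev n (swapAt n p α) = swS p (lev n α) := by
  funext r
  ext x
  rw [mem_lev, ent_swapAt hp]
  unfold swS
  rw [mem_sw, mem_lev]

lemma ascent_lt {n : ℕ} {α : Fin n → ℕ} {p : ℕ} (h : ent n α p < ent n α (p + 1)) : p + 1 < n := by
  by_contra hn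
  simp [ent, hn] at h

lemma lev_ascent {n : ℕ} {α : Fin n → ℕ} {p : ℕ} (h : ent n α p < ent n α (p + 1)) (r : ℕ) :
    ind (lev n α r) p ≤ ind (lev n α r) (p + 1) := by
  unfold ind
  simp only [mem_lev]
  split_ifs <;> omega

/-- Number of coinversions. -/
noncomputable def cinv (n : ℕ) (α : Fin n → ℕ) : ℕ :=
  (Finset.univ.filter fun q : Fin n × Fin n => q.1 < q.2 ∧ α q.1 < α q.2).card

lemma cinv_le (n : ℕ) (α : Fin n → ℕ) : cinv n α ≤ n * n := by
  refine (Finset.card_le_univ _).trans ?_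
  simp

lemma swapAt_eq {n p : ℕ} (hp : p + 1 < n) (α : Fin n → ℕ) (x : Fin n) :
    swapAt n p α x = α (Equiv.swap (⟨p, by omega⟩ : Fin n) ⟨p + 1, hp⟩ x) := by
  by_cases h1 : x = ⟨p, by omega⟩
  · subst h1
    rw [Equiv.swap_apply_left]
    simp [swapAt, ent, hp]
  by_cases h2 : x = ⟨p + 1, hp⟩
  · subst h2
    rw [Equiv.swap_apply_right]
    have : p < n := by omega
    simp [swapAt, ent, this]
  rw [Equiv.swap_apply_of_ne_of_ne h1 h2]
  have h1' : x.1 ≠ p := fun h => h1 (Fin.ext h)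
  have h2' : x.1 ≠ p + 1 := fun h => h2 (Fin.ext h)
  simp [swapAt, h1', h2']

lemma cinv_lt {n : ℕ} {α : Fin n → ℕ} {p : ℕ} (h : ent n α p < ent n α (p + 1)) :
    cinv n (swapAt n p α) < cinv n α := by
  have hp := ascent_lt h
  set P : Fin n := ⟨p, by omega⟩ with hP
  set Q : Fin n := ⟨p + 1, hp⟩ with hQ
  have hα : α P < α Q := by
    rw [← ent_val α P, ← ent_val α Q]; exact h
  have hPQ : P < Q := by rw [Fin.lt_def]; simp [hP, hQ]
  have hmem : (P, Q) ∈ Finset.univ.filter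
      fun q : Fin n × Fin n => q.1 < q.2 ∧ α q.1 < α q.2 := by
    simp [hα, hPQ]
  unfold cinv
  refine lt_of_le_of_lt ?_ (Finset.card_erase_lt_of_mem hmem)
  apply Finset.card_le_card_of_injOn (fun q => (Equiv.swap P Q q.1, Equiv.swap P Q q.2))
  · rintro ⟨x, y⟩ hq
    simp only [Finset.coe_filter, Finset.mem_univ, true_and, Set.mem_ofPred_eq,
      swapAt_eq hp] at hq
    obtain ⟨hxy, hlt⟩ := hq
    simp only [Finset.coe_erase, Finset.coe_filter, Finset.mem_univ, true_and, Set.mem_sdiff,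
      Set.mem_ofPred_eq, Set.mem_singleton_iff, Prod.mk.injEq]
    refine ⟨⟨?_, hlt⟩, ?_⟩
    · have cond : ¬ (x = P ∧ y = Q) := by
        rintro ⟨rfl, rfl⟩
        rw [Equiv.swap_apply_left, Equiv.swap_apply_right] at hlt
        exact absurd hα (not_lt.2 hlt.le)
      have cond' : ¬ (x.1 = p ∧ y.1 = p + 1) := fun hh => cond ⟨Fin.ext hh.1, Fin.ext hh.2⟩
      rw [Fin.lt_def] at hxy ⊢
      have key : ∀ z : Fin n, (Equiv.swap P Q z).1 =
          if z.1 = p then p + 1 else if z.1 = p + 1 then p else z.1 := by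
        intro z
        by_cases h1 : z = P
        · subst h1; simp [hP, hQ]
        by_cases h2 : z = Q
        · subst h2; simp [hP, hQ]
        have h1' : z.1 ≠ p := fun h => h1 (Fin.ext h)
        have h2' : z.1 ≠ p + 1 := fun h => h2 (Fin.ext h)
        rw [Equiv.swap_apply_of_ne_of_ne h1 h2]
        simp [h1', h2']
      rw [key, key]
      split_ifs <;> omega
    · rintro ⟨h1, h2⟩
      have e1 : x = Q := by
        have := congrArg (Equiv.swap P Q) h1; simpa using this
      have e2 : y = P := by
        have := congrArg (Equiv.swap P Q) h2; simpa using this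
      rw [e1, e2] at hxy
      exact absurd hxy (not_lt.2 hPQ.le)
  · rintro ⟨x, y⟩ _ ⟨x', y'⟩ _ hh
    simpa using hh

/-- Weight of a family of sets. -/
noncomputable def wtB (m : ℕ) (B : ℕ → Finset ℕ) (i : ℕ) : ℕ := ∑ r ∈ Finset.range m, ind (B r) i

/-- Weights of families below `a`. -/
def Wt (n m : ℕ) (a : ℕ → Finset ℕ) : Set (Fin n → ℕ) :=
  {β | ∃ B ∈ SS a, ∀ i : Fin n, β i = wtB m B i.1}

lemma sum_change {m : ℕ} {T : Finset ℕ} (hT : T ⊆ Finset.range m) {f g : ℕ → ℕ}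
    (h1 : ∀ r ∈ T, f r = g r + 1) (h2 : ∀ r, r ∉ T → f r = g r) :
    ∑ r ∈ Finset.range m, f r = ∑ r ∈ Finset.range m, g r + T.card := by
  have : ∀ r ∈ Finset.range m, f r = g r + if r ∈ T then 1 else 0 := by
    intro r _
    split_ifs with h
    · exact h1 r h
    · rw [h2 r h]; rfl
  rw [Finset.sum_congr rfl this, Finset.sum_add_distrib, Finset.sum_ite_mem,
    Finset.inter_eq_right.2 hT]
  simp

lemma sum_card_le {m : ℕ} {f g : ℕ → ℕ} (hf : ∀ r, f r ≤ 1) :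
    ∑ r ∈ Finset.range m, f r ≤ ∑ r ∈ Finset.range m, g r +
      ((Finset.range m).filter fun r => f r = 1 ∧ g r = 0).card := by
  rw [Finset.card_filter, ← Finset.sum_add_distrib]
  apply Finset.sum_le_sum
  intro r _
  have := hf r
  split_ifs <;> omega

lemma Le_weaken {p : ℕ} {A a : Finset ℕ} (ha : ind a p ≤ ind a (p + 1)) (h : Le A (sw p a)) :
    Le A a := by
  refine ⟨by rw [h.1, card_sw], fun k => ?_⟩
  have h0 := h.2 k
  by_cases hk : k = p + 1
  · subst hk
    rw [pref_sw_self] at h0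
    rw [pref_succ a p]; omega
  · rwa [pref_sw_ne _ _ _ hk] at h0

lemma Wt_step {n p m : ℕ} (hp : p + 1 < n) {a : ℕ → Finset ℕ}
    (ha : ∀ r, ind (a r) p ≤ ind (a r) (p + 1)) (β : Fin n → ℕ) :
    β ∈ Wt n m a ↔ ∃ β', Spread (⟨p, by omega⟩ : Fin n) ⟨p + 1, hp⟩ β' β ∧
      β' ∈ Wt n m (swS p a) := by
  constructor
  · rintro ⟨B, hB, hβ⟩
    set B' : ℕ → Finset ℕ := fun r => if ind (B r) p < ind (B r) (p + 1) then sw p (B r) else B r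
      with hB'
    have d1 : ∀ r, ind (B' r) p + ind (B' r) (p + 1) = ind (B r) p + ind (B r) (p + 1) ∧
        ind (B r) p ≤ ind (B' r) p ∧ ind (B r) (p + 1) ≤ ind (B' r) p ∧
        ∀ i, i ≠ p → i ≠ p + 1 → ind (B' r) i = ind (B r) i := by
      intro r
      simp only [hB']
      split_ifs with h
      · rw [ind_sw_left, ind_sw_right]
        exact ⟨by omega, by omega, by omega, fun i h1 h2 => ind_sw_ne _ h1 h2⟩
      · exact ⟨by omega, by omega, by omega, fun i _ _ => rfl⟩
    refine ⟨fun i => wtB m B' i.1, ⟨?_, ?_, ?_, ?_⟩, B', ?_, fun i => rfl⟩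
    · intro i h1 h2
      have h1' : i.1 ≠ p := fun h => h1 (Fin.ext h)
      have h2' : i.1 ≠ p + 1 := fun h => h2 (Fin.ext h)
      rw [hβ]
      exact Finset.sum_congr rfl fun r _ => (d1 r).2.2.2 _ h1' h2'
    · rw [hβ, hβ]
      simp only [wtB]
      rw [← Finset.sum_add_distrib, ← Finset.sum_add_distrib]
      exact Finset.sum_congr rfl fun r _ => (d1 r).1
    · rw [hβ]; exact Finset.sum_le_sum fun r _ => (d1 r).2.1
    · rw [hβ]; exact Finset.sum_le_sum fun r _ => (d1 r).2.2.1
    · intro r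
      simp only [hB', swS]
      split_ifs with h
      · have hd : ind (sw p (B r)) (p + 1) ≤ ind (sw p (B r)) p := by
          rw [ind_sw_left, ind_sw_right]; omega
        rw [(Le_lift hd (ha r)).1, ← (Le_lift hd (ha r)).2, sw_sw]
        exact hB r
      · rw [(Le_lift (by omega) (ha r)).1]
        exact hB r
  · rintro ⟨β', ⟨h1, h2, h3, h4⟩, B, hB, hβ'⟩
    set R := (Finset.range m).filter fun r => ind (B r) p = 1 ∧ ind (B r) (p + 1) = 0 with hR
    have hcard : wtB m B p ≤ wtB m B (p + 1) + R.card :=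
      sum_card_le (f := fun r => ind (B r) p) (g := fun r => ind (B r) (p + 1))
        (fun r => ind_le_one _ _)
    have e1 := hβ' ⟨p, by omega⟩
    have e2 := hβ' ⟨p + 1, hp⟩
    simp only at e1 e2
    obtain ⟨T, hTR, hT⟩ := Finset.exists_subset_card_eq
      (show β' ⟨p, by omega⟩ - β ⟨p, by omega⟩ ≤ R.card by omega)
    have hTm : T ⊆ Finset.range m := hTR.trans (Finset.filter_subset _ _)
    have hTd : ∀ r ∈ T, ind (B r) p = 1 ∧ ind (B r) (p + 1) = 0 :=
      fun r hr => (Finset.mem_filter.1 (hTR hr)).2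
    set B' : ℕ → Finset ℕ := fun r => if r ∈ T then sw p (B r) else B r with hB'
    have c1 : wtB m B p = wtB m B' p + T.card := by
      apply sum_change hTm
      · intro r hr
        obtain ⟨x, y⟩ := hTd r hr
        simp only [hB', if_pos hr, ind_sw_left]; omega
      · intro r hr; simp only [hB', if_neg hr]
    have c2 : wtB m B' (p + 1) = wtB m B (p + 1) + T.card := by
      apply sum_change hTm
      · intro r hr
        obtain ⟨x, y⟩ := hTd r hr
        simp only [hB', if_pos hr, ind_sw_right]; omega
      · intro r hr; simp only [hB', if_neg hr]
    refine ⟨B', ?_, ?_⟩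
    · intro r
      have hw := Le_weaken (ha r) (hB r)
      simp only [hB']
      split_ifs with hr
      · obtain ⟨x, y⟩ := hTd r hr
        exact (Le_lift (by omega) (ha r)).2.2 hw
      · exact hw
    · intro i
      by_cases q1 : i = ⟨p, by omega⟩
      · subst q1; simp only; omega
      by_cases q2 : i = ⟨p + 1, hp⟩
      · subst q2; simp only; omega
      rw [← h1 i q1 q2, hβ' i]
      have h1' : i.1 ≠ p := fun h => q1 (Fin.ext h)
      have h2' : i.1 ≠ p + 1 := fun h => q2 (Fin.ext h)
      apply Finset.sum_congr rfl
      intro r _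
      simp only [hB']
      split_ifs
      · rw [ind_sw_ne _ h1' h2']
      · rfl

lemma FF_card {n m : ℕ} {k : ℕ → ℕ} : ∀ x ∈ FF n m k, ∀ r, (x.1 r).card ≤ k r := by
  induction m generalizing k with
  | zero =>
    intro x hx r
    simp only [FF, Multiset.mem_singleton] at hx
    subst hx
    simp
  | succ m ih =>
    intro x hx r
    simp only [FF, step] at hx
    rw [Multiset.mem_sum] at hx
    obtain ⟨C, hC, hx⟩ := hx
    rw [Multiset.mem_map] at hx
    obtain ⟨y, hy, rfl⟩ := hx
    cases r with
    | zero => exact (Finset.mem_powersetCard.1 hC).2.le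
    | succ r => exact (card_dep_le _ _).trans (ih y hy r)

lemma ch_sum {ι : Type*} (n : ℕ) (S : Set (ℕ → Finset ℕ)) (s : Finset ι)
    (M : ι → Multiset ((ℕ → Finset ℕ) × (ℕ → ℕ))) :
    ch n S (∑ C ∈ s, M C) = ∑ C ∈ s, ch n S (M C) := by
  induction s using Finset.induction_on with
  | empty => simp [ch]
  | insert a s ha ih => rw [Finset.sum_insert ha, Finset.sum_insert ha, ch_add, ih]

lemma mw_mul (n : ℕ) (μ ν : ℕ → ℕ) : mw n (fun i => μ i + ν i) = mw n μ * mw n ν := by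
  unfold mw mono
  rw [monomial_mul, one_mul]
  refine congrArg (fun q => monomial q (1 : ℤ)) ?_
  ext i
  rfl

lemma SS_range (k : ℕ → ℕ) : SS (fun r => Finset.range (k r)) = {fun r => Finset.range (k r)} := by
  ext A
  simp only [SS, Set.mem_ofPred_eq, Set.mem_singleton_iff, Le_range, funext_iff]

lemma ch_base {n m : ℕ} {k : ℕ → ℕ} (hk : Antitone k) (hn : k 0 ≤ n) (hm : ∀ r, m ≤ r → k r = 0) :
    ch n (SS (fun r => Finset.range (k r))) (FF n m k) =
      mw n (wtB m (fun r => Finset.range (k r))) := by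
  induction m generalizing k with
  | zero =>
    have h0 : ((fun _ => ∅) : ℕ → Finset ℕ) = fun r => Finset.range (k r) := by
      funext r; rw [hm r (Nat.zero_le _)]; rfl
    have h1 : wtB 0 (fun r => Finset.range (k r)) = fun _ => 0 := by
      funext i; simp [wtB]
    rw [SS_range, FF, h1, ch, Multiset.map_singleton, Multiset.sum_singleton, if_pos]
    exact h0
  | succ m ih =>
    have ih' := ih (k := fun r => k (r + 1)) (fun a b h => hk (by omega))
      ((hk (Nat.zero_le 1)).trans hn) (fun r hr => hm _ (by omega))
    rw [SS_range] at ih' ⊢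
    rw [FF, step, ch_sum, Finset.sum_eq_single (Finset.range (k 0))]
    · have : wtB (m + 1) (fun r => Finset.range (k r)) = fun i =>
          wtB m (fun r => Finset.range (k (r + 1))) i + ind (Finset.range (k 0)) i := by
        funext i; simp only [wtB]; rw [Finset.sum_range_succ']
      rw [this, mw_mul, ← ih']
      unfold ch
      rw [Multiset.map_map, ← Multiset.sum_map_mul_right]
      congr 1
      apply Multiset.map_congr rfl
      intro x hx
      have hc := FF_card x hx
      have key : (addC (Finset.range (k 0)) x).1 = (fun r => Finset.range (k r)) ↔
          x.1 = fun r => Finset.range (k (r + 1)) := by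
        rw [funext_iff, funext_iff]
        constructor
        · intro h r
          exact (dep_eq_range (hk (Nat.zero_le _)) (hc r)).1 (h (r + 1))
        · intro h r
          cases r with
          | zero => rfl
          | succ r => exact (dep_eq_range (hk (Nat.zero_le _)) (hc r)).2 (h r)
      simp only [Function.comp, Set.mem_singleton_iff, key]
      split_ifs
      · rw [← mw_mul]; rfl
      · rw [zero_mul]
    · intro C _ hC
      unfold ch
      rw [Multiset.map_map]
      apply Multiset.sum_eq_zero
      intro y hy
      rw [Multiset.mem_map] at hy
      obtain ⟨x, _, rfl⟩ := hy
      simp only [Function.comp, Set.mem_singleton_iff]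
      rw [if_neg]
      intro h
      exact hC (congrFun h 0)
    · intro h
      exact absurd (Finset.mem_powersetCard.2
        ⟨Finset.range_subset_range.2 hn, Finset.card_range _⟩) h

lemma wtB_lev {n m : ℕ} {α : Fin n → ℕ} (hm : ∀ i, α i ≤ m) (i : Fin n) :
    wtB m (lev n α) i.1 = α i := by
  unfold wtB ind
  simp only [mem_lev, ent_val]
  rw [← Finset.card_filter]
  have : (Finset.range m).filter (fun r => r < α i) = Finset.range (α i) := by
    ext r
    simp only [Finset.mem_filter, Finset.mem_range]
    have := hm i
    omega
  rw [this, Finset.card_range]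

lemma lower_eq_range {A : Finset ℕ} (h : ∀ x ∈ A, ∀ y, y < x → y ∈ A) :
    A = Finset.range A.card := by
  have hex : ∃ m, m ∉ A := Infinite.exists_notMem_finset A
  have : A = Finset.range (Nat.find hex) := by
    ext x
    rw [Finset.mem_range]
    constructor
    · intro hx
      by_contra hn
      rcases Nat.lt_or_eq_of_le (not_lt.1 hn) with h1 | h1
      · exact Nat.find_spec hex (h x hx _ h1)
      · exact Nat.find_spec hex (h1 ▸ hx)
    · intro hx
      by_contra hn
      exact absurd (Nat.find_min' hex hn) (by omega)
  conv_rhs => rw [this, Finset.card_range]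
  exact this

lemma base_case {n m : ℕ} {α : Fin n → ℕ} (hm : ∀ i, α i ≤ m)
    (h : ¬ ∃ p : Fin n, ent n α p.1 < ent n α (p.1 + 1)) :
    mono n α = ch n (SS (lev n α)) (FF n m (fun r => (lev n α r).card)) ∧
    ∀ β, 0 < coeffOf n β (mono n α) ↔ β ∈ Wt n m (lev n α) := by
  push Not at h
  have hanti : Antitone (ent n α) := by
    apply antitone_nat_of_succ_le
    intro p
    by_cases hp : p < n
    · exact h ⟨p, hp⟩
    · have : ent n α (p + 1) = 0 := by unfold ent; rw [dif_neg (by omega)]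
      omega
  have hlev : ∀ r, lev n α r = Finset.range ((lev n α r).card) := by
    intro r
    apply lower_eq_range
    intro x hx y hy
    rw [mem_lev] at hx ⊢
    exact lt_of_lt_of_le hx (hanti hy.le)
  have hlev' : (fun r => Finset.range ((lev n α r).card)) = lev n α := by
    funext r; exact (hlev r).symm
  have hb := ch_base (n := n) (m := m) (k := fun r => (lev n α r).card)
    (fun r s hrs => Finset.card_le_card fun x hx => by
      rw [mem_lev] at hx ⊢; omega)
    (by
      refine (Finset.card_le_card (Finset.filter_subset _ _)).trans ?_
      simp)
    (by
      intro r hr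
      simp only [Finset.card_eq_zero, Finset.eq_empty_iff_forall_notMem]
      intro x hx
      rw [mem_lev] at hx
      unfold ent at hx
      split_ifs at hx with hx'
      · have := hm ⟨x, hx'⟩; omega
      · omega)
  have hS := SS_range (fun r => (lev n α r).card)
  rw [hlev'] at hb hS
  constructor
  · rw [hb]
    unfold mw
    congr 1
    funext i
    exact (wtB_lev hm i).symm
  · intro β
    rw [coeffOf_mono]
    unfold Wt
    rw [hS]
    simp only [Set.mem_singleton_iff, exists_eq_left, Set.mem_ofPred_eq, wtB_lev hm]
    constructor
    · intro hh i
      by_contra hne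
      rw [if_neg (fun e => hne (by rw [e]))] at hh
      omega
    · intro hh
      rw [if_pos (funext fun i => (hh i).symm)]
      norm_num

lemma key_main {n m : ℕ} (fuel : ℕ) : ∀ α : Fin n → ℕ, (∀ i, α i ≤ m) → cinv n α ≤ fuel →
    keyAux n fuel α = ch n (SS (lev n α)) (FF n m (fun r => (lev n α r).card)) ∧
    ∀ β, 0 < coeffOf n β (keyAux n fuel α) ↔ β ∈ Wt n m (lev n α) := by
  induction fuel with
  | zero =>
    intro α hm hc
    rw [keyAux]
    apply base_case hm
    rintro ⟨p, hp⟩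
    have := cinv_lt hp
    omega
  | succ fuel ih =>
    intro α hm hc
    rw [keyAux]
    by_cases h : ∃ p : Fin n, ent n α p.1 < ent n α (p.1 + 1)
    · rw [dif_pos h]
      have hasc := h.choose_spec
      generalize h.choose.1 = p at hasc
      have hp := ascent_lt hasc
      have hlt := cinv_lt hasc
      obtain ⟨i1, i2⟩ := ih (swapAt n p α) (fun i => by rw [swapAt_eq hp]; exact hm _) (by omega)
      have hl := lev_swapAt hp α
      have hk : (fun r => (lev n (swapAt n p α) r).card) = fun r => (lev n α r).card := by
        funext r; rw [hl]; exact card_sw _ _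
      rw [hk, hl] at i1
      rw [hl] at i2
      obtain ⟨g1, g2, g3, g4⟩ := GoodPair_FF hp (lev_ascent hasc) m (fun r => (lev n α r).card)
      have e := dem_eq hp g1
      rw [i1, e]
      refine ⟨rfl, fun β => ?_⟩
      rw [g4, Wt_step hp (lev_ascent hasc)]
      simp only [← i2, i1]
    · rw [dif_neg h]
      exact base_case hm h

lemma Le_move {A a : Finset ℕ} {i j : ℕ} (hij : i < j) (hj : j ∈ A) (hi : i ∉ A) (h : Le A a) :
    Le (insert i (A.erase j)) a := by
  have hi' : i ∉ A.erase j := fun hh => hi (Finset.mem_of_mem_erase hh)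
  constructor
  · rw [Finset.card_insert_of_notMem hi', Finset.card_erase_add_one hj]
    exact h.1
  · have key : ∀ k, pref (insert i (A.erase j)) k + (if j < k then 1 else 0) =
        pref A k + (if i < k then 1 else 0) := by
      intro k
      induction k with
      | zero => simp [pref_zero]
      | succ k ih =>
        rw [pref_succ, pref_succ]
        have e : ind (insert i (A.erase j)) k =
            if k = i then 1 else if k = j then 0 else ind A k := by
          unfold ind
          by_cases h1 : k = i
          · simp [h1]
          by_cases h2 : k = j
          · subst h2; simp [h1]
          · simp [h1, h2]
        have ei : ind A i = 0 := if_neg hi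
        have ej : ind A j = 1 := if_pos hj
        rw [e]
        by_cases h1 : k = i
        · subst h1
          simp only [if_true]
          split_ifs at * <;> omega
        by_cases h2 : k = j
        · subst h2
          simp only [if_true]
          split_ifs at * <;> omega
        · split_ifs at * <;> omega
    intro k
    have h1 := key k
    have h2 := h.2 k
    split_ifs at h1 <;> omega

lemma Wt_move {n m : ℕ} {a : ℕ → Finset ℕ} {β : Fin n → ℕ} (hβ : β ∈ Wt n m a) {i j : Fin n}
    (hij : i < j) {s : ℕ} (hs : β i + s ≤ β j) :
    (fun x => if x = i then β i + s else if x = j then β j - s else β x) ∈ Wt n m a := by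
  obtain ⟨B, hB, hw⟩ := hβ
  set R := (Finset.range m).filter fun r => ind (B r) j = 1 ∧ ind (B r) i = 0 with hR
  have hcard : wtB m B j ≤ wtB m B i + R.card :=
    sum_card_le (f := fun r => ind (B r) j) (g := fun r => ind (B r) i)
      (fun r => ind_le_one _ _)
  rw [← hw, ← hw] at hcard
  obtain ⟨T, hTR, hT⟩ := Finset.exists_subset_card_eq (show s ≤ R.card by omega)
  have hTm : T ⊆ Finset.range m := hTR.trans (Finset.filter_subset _ _)
  have hTd : ∀ r ∈ T, ind (B r) j = 1 ∧ ind (B r) i = 0 :=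
    fun r hr => (Finset.mem_filter.1 (hTR hr)).2
  have hne : i.1 ≠ j.1 := (Fin.lt_def.1 hij).ne
  set B' : ℕ → Finset ℕ := fun r => if r ∈ T then insert i.1 ((B r).erase j.1) else B r with hB'
  have c1 : wtB m B j = wtB m B' j + T.card := by
    apply sum_change hTm
    · intro r hr
      obtain ⟨x, y⟩ := hTd r hr
      simp only [hB', if_pos hr, x]
      simp [ind, hne.symm]
    · intro r hr; simp only [hB', if_neg hr]
  have c2 : wtB m B' i = wtB m B i + T.card := by
    apply sum_change hTm
    · intro r hr
      obtain ⟨x, y⟩ := hTd r hr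
      simp only [hB', if_pos hr, y]
      simp [ind]
    · intro r hr; simp only [hB', if_neg hr]
  refine ⟨B', ?_, ?_⟩
  · intro r
    simp only [hB']
    split_ifs with hr
    · obtain ⟨x, y⟩ := hTd r hr
      refine Le_move (Fin.lt_def.1 hij) ((mem_iff_ind _ _).2 x) ?_ (hB r)
      rw [mem_iff_ind]; omega
    · exact hB r
  · intro x
    have w1 := hw i
    have w2 := hw j
    by_cases q1 : x = i
    · subst q1; simp only [if_true]; omega
    by_cases q2 : x = j
    · subst q2; simp only [if_neg q1, if_true]; omega
    simp only [if_neg q1, if_neg q2]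
    rw [hw x]
    have q1' : x.1 ≠ i.1 := fun h => q1 (Fin.ext h)
    have q2' : x.1 ≠ j.1 := fun h => q2 (Fin.ext h)
    apply Finset.sum_congr rfl
    intro r _
    simp only [hB']
    split_ifs
    · simp [ind, q1', q2']
    · rfl

end LSS

namespace LSS

/-- Corollary 4.6: if `[x^β] κ_α > 0`, `i < j`, `β_j − β_i = t > 0`, then
for each `1 ≤ s ≤ t`, moving `s` units from position `j` to position `i` again gives a
monomial of `κ_α` with positive coefficient. -/
theorem stmt8 (n : ℕ) (α β : Fin n → ℕ) (hβ : 0 < coeffOf n β (keyPoly n α))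
    (i j : Fin n) (hij : i < j) (t : ℕ) (ht : 0 < t) (hdiff : β j = β i + t)
    (s : ℕ) (hs1 : 1 ≤ s) (hs2 : s ≤ t) :
    0 < coeffOf n
      (fun m => if m = i then β i + s else if m = j then β j - s else β m)
      (keyPoly n α) := by
  obtain ⟨-, key⟩ := key_main (m := Finset.univ.sup α) (n * n) α
    (fun i => Finset.le_sup (Finset.mem_univ i)) (cinv_le n α)
  unfold keyPoly at hβ ⊢
  rw [key] at hβ ⊢
  exact Wt_move hβ hij (by omega)

end LSS
end

section
/- Fix D = {d_1 < … < d_k} ⊆ [n−1] with d_0 = 0, d_{k+1} = n, and I = [n−1] ∖ D. For every β ∈ ℤ_{≥0}^n, the polynomial π_{w_0(I)}(x_1^{β_1}⋯x_n^{β_n}) is either 0, or equals ε·s_{α^1,…,α^{k+1}} for some sign ε ∈ {1,−1} and some (α^1,…,α^{k+1}) ∈ Par_D. -/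
open scoped Classical

namespace LSS
open MvPolynomial

theorem X_sub_dvd_swap {n : ℕ} (a b : Fin n) (f : MvPolynomial (Fin n) ℤ) :
    (X a - X b : MvPolynomial (Fin n) ℤ) ∣ f - rename (Equiv.swap a b) f := by
  induction f using MvPolynomial.induction_on with
  | C r => simp
  | add p q hp hq =>
    rw [map_add, add_sub_add_comm]; exact dvd_add hp hq
  | mul_X p i hp =>
    rw [map_mul, rename_X]
    have h : p * X i - rename (Equiv.swap a b) p * X (Equiv.swap a b i)
      = (p - rename (Equiv.swap a b) p) * X i
        + rename (Equiv.swap a b) p * (X i - X (Equiv.swap a b i)) := by ring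
    rw [h]
    refine dvd_add (hp.mul_right _) (Dvd.dvd.mul_left ?_ _)
    by_cases ha : i = a
    · subst ha; simp
    · by_cases hb : i = b
      · subst hb; rw [Equiv.swap_apply_right]; exact dvd_sub_comm.1 dvd_rfl
      · rw [Equiv.swap_apply_of_ne_of_ne ha hb]; simp

/-- rename by a permutation, as algebra hom -/
noncomputable def ac {n : ℕ} (w : Equiv.Perm (Fin n)) :
    MvPolynomial (Fin n) ℤ →ₐ[ℤ] MvPolynomial (Fin n) ℤ := rename w

theorem ac_X {n : ℕ} (w : Equiv.Perm (Fin n)) (p : Fin n) : ac w (X p) = X (w p) := by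
  simp [ac]

theorem ac_mul {n : ℕ} (u v : Equiv.Perm (Fin n)) (f) : ac (u * v) f = ac u (ac v f) := by
  simp [ac, rename_rename]

theorem ac_one {n : ℕ} (f) : ac (1 : Equiv.Perm (Fin n)) f = f := by
  simp [ac]

theorem dem_spec {n : ℕ} (i : ℕ) (h0 : 0 < i) (h1 : i < n) (f : MvPolynomial (Fin n) ℤ) :
    (X (⟨i - 1, by omega⟩ : Fin n) - X (⟨i, h1⟩ : Fin n)) * dem n i f =
      X (⟨i - 1, by omega⟩ : Fin n) * f - X (⟨i, h1⟩ : Fin n) * ac (st n i) f := by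
  have hex : ∃ g, (X (⟨i - 1, by omega⟩ : Fin n) - X (⟨i, h1⟩ : Fin n)) * g =
        X (⟨i - 1, by omega⟩ : Fin n) * f -
          X (⟨i, h1⟩ : Fin n) *
            rename (⇑(Equiv.swap (⟨i - 1, by omega⟩ : Fin n) (⟨i, h1⟩ : Fin n))) f := by
    obtain ⟨g, hg⟩ := X_sub_dvd_swap (⟨i - 1, by omega⟩ : Fin n) ⟨i, h1⟩ f
    refine ⟨f + X ⟨i, h1⟩ * g, ?_⟩
    linear_combination (- X ⟨i, h1⟩) * hg
  unfold dem
  rw [dif_pos ⟨h0, h1⟩, dif_pos hex]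
  have := hex.choose_spec
  rw [this]
  simp only [ac, st]
  rw [dif_pos ⟨h0, h1⟩]

theorem X_sub_ne {n : ℕ} {a b : Fin n} (h : a ≠ b) :
    (X a - X b : MvPolynomial (Fin n) ℤ) ≠ 0 := by
  rw [sub_ne_zero]
  exact fun e => h (X_injective e)

theorem st_eq {n : ℕ} (i : ℕ) (h0 : 0 < i) (h1 : i < n) :
    st n i = Equiv.swap ⟨i - 1, by omega⟩ ⟨i, h1⟩ := by
  unfold st; rw [dif_pos ⟨h0, h1⟩]

theorem st_mul_self (n i : ℕ) : st n i * st n i = 1 := by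
  unfold st; split_ifs <;> simp

theorem st_inv (n i : ℕ) : (st n i)⁻¹ = st n i :=
  inv_eq_of_mul_eq_one_left (st_mul_self n i)

theorem dem_symm {n : ℕ} (i : ℕ) (h0 : 0 < i) (h1 : i < n) (f : MvPolynomial (Fin n) ℤ) :
    ac (st n i) (dem n i f) = dem n i f := by
  have h := dem_spec i h0 h1 f
  have h' := congrArg (ac (st n i)) h
  simp only [map_sub, map_mul, ac_X, ← ac_mul, st_mul_self, ac_one] at h'
  rw [st_eq i h0 h1, Equiv.swap_apply_left, Equiv.swap_apply_right, ← st_eq i h0 h1] at h'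
  have hne : (X (⟨i - 1, by omega⟩ : Fin n) - X (⟨i, h1⟩ : Fin n) : MvPolynomial (Fin n) ℤ) ≠ 0 :=
    X_sub_ne (by simp [Fin.ext_iff]; omega)
  apply mul_left_cancel₀ hne
  linear_combination -h' - h

/-- Abstract braid computation. -/
theorem braid_aux {R : Type*} [CommRing R] (s t : R →+* R) (a b c f g1 g2 g3 : R)
    (sa : s a = b) (sb : s b = a) (sc : s c = c) (ta : t a = a) (tb : t b = c) (tc : t c = b)
    (h1 : (a - b) * g1 = a * f - b * s f) (h1s : s g1 = g1)
    (h2 : (b - c) * g2 = b * g1 - c * t g1)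
    (h3 : (a - b) * g3 = a * g2 - b * s g2) :
    (a - b) * (b - c) * (a - c) * g3 = a ^ 2 * b * f - a * b ^ 2 * s f - a ^ 2 * c * t f
      + a * c ^ 2 * t (s f) + b ^ 2 * c * s (t f) - b * c ^ 2 * s (t (s f)) := by
  have e1 := congrArg t h1
  have e2 := congrArg s h2
  have e3 := congrArg s e1
  simp only [map_sub, map_mul, sa, sb, sc, ta, tb, tc, h1s] at e1 e2 e3
  linear_combination (b - c) * (a - c) * h3 + a * (a - c) * h2 - b * (b - c) * e2
    + a * b * h1 - a * c * e1 + b * c * e3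

theorem braid_aux' {R : Type*} [CommRing R] (s t : R →+* R) (a b c f g1 g2 g3 : R)
    (sa : s a = b) (sb : s b = a) (sc : s c = c) (ta : t a = a) (tb : t b = c) (tc : t c = b)
    (h1 : (b - c) * g1 = b * f - c * t f) (h1s : t g1 = g1)
    (h2 : (a - b) * g2 = a * g1 - b * s g1)
    (h3 : (b - c) * g3 = b * g2 - c * t g2) :
    (a - b) * (b - c) * (a - c) * g3 = a ^ 2 * b * f - a * b ^ 2 * s f - a ^ 2 * c * t f
      + a * c ^ 2 * t (s f) + b ^ 2 * c * s (t f) - b * c ^ 2 * t (s (t f)) := by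
  have e1 := congrArg s h1
  have e2 := congrArg t h2
  have e3 := congrArg t e1
  simp only [map_sub, map_mul, sa, sb, sc, ta, tb, tc, h1s] at e1 e2 e3
  linear_combination (a - b) * (a - c) * h3 + b * (a - c) * h2 - c * (a - b) * e2
    + a * a * h1 - b * b * e1 + c * c * e3

theorem st_braid {n : ℕ} (i : ℕ) (h0 : 0 < i) (h1 : i + 1 < n) :
    st n i * st n (i + 1) * st n i = st n (i + 1) * st n i * st n (i + 1) := by
  rw [st_eq i h0 (by omega), st_eq (i + 1) (by omega) h1]
  have hab : (⟨i - 1, by omega⟩ : Fin n) ≠ ⟨i, by omega⟩ := by simp [Fin.ext_iff]; omega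
  have hac : (⟨i - 1, by omega⟩ : Fin n) ≠ ⟨i + 1, by omega⟩ := by simp only [ne_eq, Fin.ext_iff]; omega
  have hbc : (⟨i, by omega⟩ : Fin n) ≠ ⟨i + 1, by omega⟩ := by simp [Fin.ext_iff]
  have e : (⟨i + 1 - 1, by omega⟩ : Fin n) = ⟨i, by omega⟩ := by simp
  rw [e]
  rw [Equiv.swap_comm (⟨i - 1, by omega⟩ : Fin n) ⟨i, by omega⟩,
    Equiv.swap_comm (⟨i, by omega⟩ : Fin n) ⟨i + 1, by omega⟩]
  rw [Equiv.swap_mul_swap_mul_swap (by exact hbc.symm) (by exact hac.symm)]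
  rw [Equiv.swap_comm (⟨i, by omega⟩ : Fin n) ⟨i - 1, by omega⟩,
    Equiv.swap_comm (⟨i + 1, by omega⟩ : Fin n) ⟨i, by omega⟩]
  rw [Equiv.swap_mul_swap_mul_swap (by exact hab) (by exact hac), Equiv.swap_comm]

theorem dem_braid {n : ℕ} (i : ℕ) (h0 : 0 < i) (h1 : i + 1 < n) (f) :
    dem n i (dem n (i + 1) (dem n i f)) = dem n (i + 1) (dem n i (dem n (i + 1) f)) := by
  have hi : i < n := by omega
  set a : Fin n := ⟨i - 1, by omega⟩ with ha
  set b : Fin n := ⟨i, by omega⟩ with hb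
  set c : Fin n := ⟨i + 1, by omega⟩ with hc
  have hab : a ≠ b := by simp only [a, b, ne_eq, Fin.ext_iff]; omega
  have hac : a ≠ c := by simp only [a, c, ne_eq, Fin.ext_iff]; omega
  have hbc : b ≠ c := by simp [b, c, Fin.ext_iff]
  have S := fun f => dem_spec i h0 hi f
  have T := fun f => dem_spec (n := n) (i + 1) (by omega) h1 f
  have S' : ∀ f, (X a - X b) * dem n i f = X a * f - X b * (ac (st n i)).toRingHom f := S
  have T' : ∀ f, (X b - X c) * dem n (i+1) f = X b * f - X c * (ac (st n (i+1))).toRingHom f := T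
  have es : st n i = Equiv.swap a b := st_eq i h0 hi
  have et : st n (i+1) = Equiv.swap b c := st_eq (i+1) (by omega) h1
  have sa : (ac (st n i)).toRingHom (X a) = X b := by
    change ac _ _ = _; rw [ac_X, es]; simp
  have sb : (ac (st n i)).toRingHom (X b) = X a := by
    change ac _ _ = _; rw [ac_X, es]; simp
  have sc : (ac (st n i)).toRingHom (X c) = X c := by
    change ac _ _ = _; rw [ac_X, es, Equiv.swap_apply_of_ne_of_ne hac.symm hbc.symm]
  have ta : (ac (st n (i+1))).toRingHom (X a) = X a := by
    change ac _ _ = _; rw [ac_X, et, Equiv.swap_apply_of_ne_of_ne hab hac]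
  have tb : (ac (st n (i+1))).toRingHom (X b) = X c := by
    change ac _ _ = _; rw [ac_X, et]; simp
  have tc : (ac (st n (i+1))).toRingHom (X c) = X b := by
    change ac _ _ = _; rw [ac_X, et]; simp
  have A := braid_aux _ _ _ _ _ f _ _ _ sa sb sc ta tb tc (S' f) (dem_symm i h0 hi f)
    (T' _) (S' _)
  have B := braid_aux' _ _ _ _ _ f _ _ _ sa sb sc ta tb tc (T' f)
    (dem_symm (i+1) (by omega) h1 f) (S' _) (T' _)
  have C : (ac (st n i)).toRingHom ((ac (st n (i+1))).toRingHom ((ac (st n i)).toRingHom f))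
     = (ac (st n (i+1))).toRingHom ((ac (st n i)).toRingHom ((ac (st n (i+1))).toRingHom f)) := by
    change ac _ (ac _ (ac _ _)) = ac _ (ac _ (ac _ _))
    simp only [← ac_mul, ← mul_assoc]
    rw [st_braid i h0 h1]
  rw [C] at A
  exact mul_left_cancel₀ (mul_ne_zero (mul_ne_zero (X_sub_ne hab) (X_sub_ne hbc)) (X_sub_ne hac))
    (A.trans B.symm)

theorem st_comm {n : ℕ} (i j : ℕ) (h0 : 0 < i) (h1 : i + 1 < j) (h2 : j < n) :
    st n i * st n j = st n j * st n i := by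
  rw [st_eq i h0 (by omega), st_eq j (by omega) h2]
  apply Equiv.Perm.Disjoint.commute
  intro x
  by_cases h : x.1 = i - 1 ∨ x.1 = i
  · right
    apply Equiv.swap_apply_of_ne_of_ne <;> (simp only [ne_eq, Fin.ext_iff]; omega)
  · left
    apply Equiv.swap_apply_of_ne_of_ne <;> (simp only [ne_eq, Fin.ext_iff]; omega)

theorem dem_comm {n : ℕ} (i j : ℕ) (h0 : 0 < i) (h1 : i + 1 < j) (h2 : j < n) (f) :
    dem n i (dem n j f) = dem n j (dem n i f) := by
  have S := fun f => dem_spec (n := n) i h0 (by omega) f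
  have T := fun f => dem_spec (n := n) j (by omega) h2 f
  have es : st n i = Equiv.swap ⟨i - 1, by omega⟩ ⟨i, by omega⟩ := st_eq i h0 (by omega)
  have et : st n j = Equiv.swap ⟨j - 1, by omega⟩ ⟨j, by omega⟩ := st_eq j (by omega) h2
  set a : Fin n := ⟨i - 1, by omega⟩ with ha
  set b : Fin n := ⟨i, by omega⟩ with hb
  set c : Fin n := ⟨j - 1, by omega⟩ with hc
  set d : Fin n := ⟨j, by omega⟩ with hd
  have hab : a ≠ b := by simp only [a, b, ne_eq, Fin.ext_iff]; omega
  have hcd : c ≠ d := by simp only [c, d, ne_eq, Fin.ext_iff]; omega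
  have hac : a ≠ c := by simp only [a, c, ne_eq, Fin.ext_iff]; omega
  have hbc : b ≠ c := by simp only [b, c, ne_eq, Fin.ext_iff]; omega
  have had : a ≠ d := by simp only [a, d, ne_eq, Fin.ext_iff]; omega
  have hbd : b ≠ d := by simp only [b, d, ne_eq, Fin.ext_iff]; omega
  have sc : ac (st n i) (X c) = X c := by
    rw [ac_X, es, Equiv.swap_apply_of_ne_of_ne hac.symm hbc.symm]
  have sd : ac (st n i) (X d) = X d := by
    rw [ac_X, es, Equiv.swap_apply_of_ne_of_ne had.symm hbd.symm]
  have ta : ac (st n j) (X a) = X a := by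
    rw [ac_X, et, Equiv.swap_apply_of_ne_of_ne hac had]
  have tb : ac (st n j) (X b) = X b := by
    rw [ac_X, et, Equiv.swap_apply_of_ne_of_ne hbc hbd]
  have e1 := congrArg (ac (st n i)) (T f)
  have e2 := congrArg (ac (st n j)) (S f)
  simp only [map_sub, map_mul, sc, sd, ta, tb] at e1 e2
  have C : ac (st n i) (ac (st n j) f) = ac (st n j) (ac (st n i) f) := by
    simp only [← ac_mul]; rw [st_comm i j h0 h1 h2]
  apply mul_left_cancel₀ (mul_ne_zero (X_sub_ne hab) (X_sub_ne hcd))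
  linear_combination (X c - X d) * S (dem n j f) - (X a - X b) * T (dem n i f)
    + X a * T f - X b * e1 - X c * S f + X d * e2 + X b * X d * C

end LSS

namespace LSS
open MvPolynomial

/-- `i` is a left descent of `w`. -/
def Desc (n : ℕ) (i : ℕ) (w : Equiv.Perm (Fin n)) : Prop :=
  ∃ (_ : 0 < i) (h1 : i < n), w⁻¹ ⟨i, h1⟩ < w⁻¹ ⟨i - 1, by omega⟩

theorem len_st_up {n : ℕ} (i : ℕ) (h0 : 0 < i) (h1 : i < n) (w : Equiv.Perm (Fin n))
    (h : w⁻¹ ⟨i - 1, by omega⟩ < w⁻¹ ⟨i, h1⟩) : len n (st n i * w) = len n w + 1 := by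
  unfold len
  have key : (Finset.univ.filter fun p : Fin n × Fin n =>
      p.1 < p.2 ∧ (st n i * w) p.2 < (st n i * w) p.1) =
    insert (w⁻¹ ⟨i - 1, by omega⟩, w⁻¹ ⟨i, h1⟩)
      (Finset.univ.filter fun p : Fin n × Fin n => p.1 < p.2 ∧ w p.2 < w p.1) := by
    ext ⟨p, q⟩
    rw [Finset.mem_insert, Finset.mem_filter, Finset.mem_filter]
    simp only [Finset.mem_univ, true_and, Prod.mk.injEq,
      Equiv.Perm.mul_apply, Equiv.Perm.eq_inv_iff_eq]
    have hp : p = w⁻¹ (w p) := by simp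
    have hq : q = w⁻¹ (w q) := by simp
    generalize hx : w p = x at *
    generalize hy : w q = y at *
    rw [st_eq i h0 h1, Equiv.swap_apply_def, Equiv.swap_apply_def]
    have hxy : x = y ↔ p = q := by rw [← hx, ← hy]; simp
    have hneq : (p < q) → x ≠ y := fun h e => by rw [hxy.1 e] at h; exact lt_irrefl _ h
    by_cases hpq : p < q
    · have hne := hneq hpq
      have hcon : ¬ (x = ⟨i, h1⟩ ∧ y = ⟨i - 1, by omega⟩) := by
        rintro ⟨e1, e2⟩
        rw [← e1, ← e2, ← hp, ← hq] at h
        exact lt_asymm h hpq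
      simp only [hpq, true_and]
      simp only [Fin.lt_def, Fin.ext_iff, ne_eq] at *
      split_ifs <;> (try simp only) <;> omega
    · simp only [hpq, false_and, or_false, false_iff]
      rintro ⟨e1, e2⟩
      rw [← e1, ← e2, ← hp, ← hq] at h
      exact hpq h
  rw [key, Finset.card_insert_of_notMem]
  simp only [Finset.mem_filter, Finset.mem_univ, true_and, not_and, not_lt]
  intro _
  simp [Fin.le_def]

theorem len_st_down {n : ℕ} (i : ℕ) (w : Equiv.Perm (Fin n))
    (h : Desc n i w) : len n (st n i * w) + 1 = len n w := by
  obtain ⟨h0, h1, h⟩ := h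
  have := len_st_up i h0 h1 (st n i * w) (by
    rw [mul_inv_rev, st_inv, Equiv.Perm.mul_apply, Equiv.Perm.mul_apply, st_eq i h0 h1]
    simpa using h)
  rw [← mul_assoc, st_mul_self, one_mul] at this
  exact this.symm

theorem desc_of_len {n : ℕ} (i : ℕ) (h0 : 0 < i) (h1 : i < n) (w : Equiv.Perm (Fin n))
    (h : len n (st n i * w) < len n w + 1) : Desc n i w := by
  refine ⟨h0, h1, ?_⟩
  rcases lt_trichotomy (w⁻¹ ⟨i, h1⟩) (w⁻¹ ⟨i - 1, by omega⟩) with h2 | h2 | h2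
  · exact h2
  · have := w⁻¹.injective h2
    simp [Fin.ext_iff] at this; omega
  · have := len_st_up i h0 h1 w h2; omega

theorem exists_desc {n : ℕ} (w : Equiv.Perm (Fin n)) (hw : w ≠ 1) : ∃ i, Desc n i w := by
  by_contra hcon
  push Not at hcon
  apply hw
  have hm : StrictMono (w⁻¹ : Equiv.Perm (Fin n)) := by
    cases n with
    | zero => intro a; exact a.elim0
    | succ m =>
      rw [Fin.strictMono_iff_lt_succ]
      intro i
      have h := hcon (i.1 + 1)
      by_contra h2
      apply h
      refine ⟨by omega, by omega, ?_⟩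
      refine lt_of_le_of_ne (not_lt.1 h2) ?_
      intro e
      have := w⁻¹.injective e
      simp [Fin.ext_iff] at this
  have : (w⁻¹ : Equiv.Perm (Fin n)) = 1 := by
    ext x
    have hid := Subsingleton.elim (hm.orderIsoOfSurjective _ w⁻¹.surjective) (OrderIso.refl (Fin n))
    have := congrArg (fun f => f x) hid
    simp at this
    simp [this]
  simpa using this

theorem len_one (n : ℕ) : len n 1 = 0 := by
  unfold len
  rw [Finset.card_eq_zero, Finset.filter_eq_empty_iff]
  rintro p - ⟨h1, h2⟩
  exact lt_asymm h1 h2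

theorem redWord_cons {n i : ℕ} {L : List ℕ} {w : Equiv.Perm (Fin n)} (h : IsRedWord n L (st n i * w))
    (hd : Desc n i w) : IsRedWord n (i :: L) w := by
  obtain ⟨a, b, c⟩ := h
  have hl := len_st_down i w hd
  obtain ⟨h0, h1, _⟩ := hd
  refine ⟨?_, ?_, ?_⟩
  · intro j hj
    rcases List.mem_cons.1 hj with rfl | hj
    · omega
    · exact a j hj
  · rw [List.map_cons, List.prod_cons, b, ← mul_assoc, st_mul_self, one_mul]
  · rw [List.length_cons, c, hl]

theorem len_prod_le {n : ℕ} (L : List ℕ) (hL : ∀ i ∈ L, 1 ≤ i ∧ i ≤ n - 1) :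
    len n (L.map (st n)).prod ≤ L.length := by
  induction L with
  | nil => simp [len_one]
  | cons i L ih =>
    have ih := ih (fun j hj => hL j (List.mem_cons_of_mem _ hj))
    have hi := hL i List.mem_cons_self
    rw [List.map_cons, List.prod_cons, List.length_cons]
    set w := (L.map (st n)).prod
    by_cases hd : len n (st n i * w) < len n w + 1
    · omega
    · have : ¬ w⁻¹ ⟨i, by omega⟩ < w⁻¹ ⟨i - 1, by omega⟩ := by
        intro h
        have := len_st_down i w ⟨by omega, by omega, h⟩
        omega
      have h2 : w⁻¹ ⟨i - 1, by omega⟩ < w⁻¹ ⟨i, by omega⟩ := by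
        refine lt_of_le_of_ne (not_lt.1 this) ?_
        intro e
        have := w⁻¹.injective e
        simp [Fin.ext_iff] at this; omega
      have := len_st_up i (by omega) (by omega) w h2
      omega

theorem redWord_uncons {n i : ℕ} {L : List ℕ} {w : Equiv.Perm (Fin n)}
    (h : IsRedWord n (i :: L) w) : Desc n i w ∧ IsRedWord n L (st n i * w) := by
  obtain ⟨a, b, c⟩ := h
  have hi := a i List.mem_cons_self
  have a' : ∀ j ∈ L, 1 ≤ j ∧ j ≤ n - 1 := fun j hj => a j (List.mem_cons_of_mem _ hj)
  rw [List.map_cons, List.prod_cons] at b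
  have b' : (L.map (st n)).prod = st n i * w := by
    rw [← b, ← mul_assoc, st_mul_self, one_mul]
  have hle := len_prod_le L a'
  rw [b'] at hle
  rw [List.length_cons] at c
  have hd : Desc n i w := desc_of_len i (by omega) (by omega) w (by omega)
  exact ⟨hd, a', b', by have := len_st_down i w hd; omega⟩

theorem exists_redWord {n : ℕ} (w : Equiv.Perm (Fin n)) : ∃ L, IsRedWord n L w := by
  induction hl : len n w using Nat.strong_induction_on generalizing w with
  | _ l ih =>
    by_cases hw : w = 1
    · subst hw
      exact ⟨[], by simp, by simp, by simp [len_one]⟩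
    · obtain ⟨i, hi⟩ := exists_desc w hw
      have := len_st_down i w hi
      obtain ⟨L, hL⟩ := ih (len n (st n i * w)) (by omega) _ rfl
      exact ⟨_, redWord_cons hL hi⟩

theorem st_apply_of_ne {n i : ℕ} (x : Fin n) (h1 : x.1 ≠ i - 1) (h2 : x.1 ≠ i) :
    st n i x = x := by
  unfold st
  split_ifs with h
  · apply Equiv.swap_apply_of_ne_of_ne <;> (simp only [ne_eq, Fin.ext_iff]; omega)
  · rfl

theorem st_apply_left {n i : ℕ} (h0 : 0 < i) (h1 : i < n) :
    st n i ⟨i - 1, by omega⟩ = ⟨i, h1⟩ := by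
  rw [st_eq i h0 h1]; simp

theorem st_apply_right {n i : ℕ} (h0 : 0 < i) (h1 : i < n) :
    st n i ⟨i, h1⟩ = ⟨i - 1, by omega⟩ := by
  rw [st_eq i h0 h1]; simp

theorem desc_far {n i j : ℕ} {w : Equiv.Perm (Fin n)} (hij : i + 1 < j ∨ j + 1 < i)
    (hi : Desc n i w) (hj : Desc n j w) : Desc n i (st n j * w) := by
  obtain ⟨h0, h1, h⟩ := hi
  obtain ⟨h0', h1', h'⟩ := hj
  refine ⟨h0, h1, ?_⟩
  rw [mul_inv_rev, st_inv, Equiv.Perm.mul_apply, Equiv.Perm.mul_apply,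
    st_apply_of_ne _ (by simp only; omega) (by simp only; omega),
    st_apply_of_ne _ (by simp only; omega) (by simp only; omega)]
  exact h

theorem matsumoto {n : ℕ} (w : Equiv.Perm (Fin n)) (L L' : List ℕ) (h : IsRedWord n L w)
    (h' : IsRedWord n L' w) (f : MvPolynomial (Fin n) ℤ) : demWord n L f = demWord n L' f := by
  induction hl : len n w using Nat.strong_induction_on generalizing w L L' with
  | _ l ih =>
    cases L with
    | nil =>
      have e : L'.length = 0 := by rw [h'.2.2, ← h.2.2]; rfl
      rw [List.length_eq_zero_iff] at e
      rw [e]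
    | cons i L =>
    cases L' with
    | nil =>
      have e : (i :: L).length = 0 := by rw [h.2.2, ← h'.2.2]; rfl
      simp at e
    | cons j M =>
      obtain ⟨di, hL⟩ := redWord_uncons h
      obtain ⟨dj, hM⟩ := redWord_uncons h'
      have li := len_st_down i w di
      have lj := len_st_down j w dj
      -- wlog i < j
      have main : ∀ i j : ℕ, ∀ L M : List ℕ, i < j → Desc n i w → Desc n j w →
          IsRedWord n L (st n i * w) → IsRedWord n M (st n j * w) →
          dem n i (demWord n L f) = dem n j (demWord n M f) := by
        intro i j L M hij di dj hL hM
        have li := len_st_down i w di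
        have lj := len_st_down j w dj
        by_cases hfar : i + 1 < j
        · have d1 := desc_far (Or.inr hfar) dj di
          have d2 := desc_far (Or.inl hfar) di dj
          obtain ⟨h0, h1, _⟩ := di
          obtain ⟨h0', h1', _⟩ := dj
          obtain ⟨U, hU⟩ := exists_redWord (st n j * (st n i * w))
          have hU' : IsRedWord n U (st n i * (st n j * w)) := by
            rwa [← mul_assoc, st_comm i j h0 hfar h1', mul_assoc]
          have r1 := redWord_cons hU d1
          have r2 := redWord_cons hU' d2
          have e1 := ih (len n (st n i * w)) (by omega) _ L _ hL r1 rfl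
          have e2 := ih (len n (st n j * w)) (by omega) _ M _ hM r2 rfl
          rw [e1, e2]
          exact dem_comm i j h0 hfar h1' _
        · obtain rfl : j = i + 1 := by omega
          have di' := di
          have dj' := dj
          obtain ⟨h0, h1, hi⟩ := di'
          obtain ⟨h0', h1', hj⟩ := dj'
          have ei : (⟨i + 1 - 1, by omega⟩ : Fin n) = ⟨i, h1⟩ := by simp
          rw [ei] at hj
          have sa := st_apply_left h0 h1
          have sb := st_apply_right h0 h1
          have sc : st n i ⟨i + 1, h1'⟩ = ⟨i + 1, h1'⟩ :=
            st_apply_of_ne _ (by simp only; omega) (by simp only; omega)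
          have ta : st n (i + 1) ⟨i - 1, by omega⟩ = ⟨i - 1, by omega⟩ :=
            st_apply_of_ne _ (by simp only; omega) (by simp only; omega)
          have tb : st n (i + 1) ⟨i, h1⟩ = ⟨i + 1, h1'⟩ := st_apply_left h0' h1'
          have tc : st n (i + 1) ⟨i + 1, h1'⟩ = ⟨i, h1⟩ := st_apply_right h0' h1'
          have d1 : Desc n (i + 1) (st n i * w) := by
            refine ⟨h0', h1', ?_⟩
            rw [ei]
            simp only [mul_inv_rev, st_inv, Equiv.Perm.mul_apply, sa, sb, sc]
            exact hj.trans hi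
          have d2 : Desc n i (st n (i + 1) * (st n i * w)) := by
            refine ⟨h0, h1, ?_⟩
            simp only [mul_inv_rev, st_inv, Equiv.Perm.mul_apply, sa, sb, sc, ta, tb, tc]
            exact hj
          have d3 : Desc n i (st n (i + 1) * w) := by
            refine ⟨h0, h1, ?_⟩
            simp only [mul_inv_rev, st_inv, Equiv.Perm.mul_apply, sa, sb, sc, ta, tb, tc]
            exact hj.trans hi
          have d4 : Desc n (i + 1) (st n i * (st n (i + 1) * w)) := by
            refine ⟨h0', h1', ?_⟩
            rw [ei]
            simp only [mul_inv_rev, st_inv, Equiv.Perm.mul_apply, sa, sb, sc, ta, tb, tc]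
            exact hi
          obtain ⟨U, hU⟩ := exists_redWord (st n i * (st n (i + 1) * (st n i * w)))
          have hU' : IsRedWord n U (st n (i + 1) * (st n i * (st n (i + 1) * w))) := by
            rw [← mul_assoc, ← mul_assoc, ← st_braid i h0 h1']
            rwa [← mul_assoc, ← mul_assoc] at hU
          have r1 := redWord_cons (redWord_cons hU d2) d1
          have r2 := redWord_cons (redWord_cons hU' d4) d3
          have e1 := ih (len n (st n i * w)) (by omega) _ L _ hL r1 rfl
          have e2 := ih (len n (st n (i + 1) * w)) (by omega) _ M _ hM r2 rfl
          rw [e1, e2]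
          exact dem_braid i h0 h1' _
      change dem n i (demWord n L f) = dem n j (demWord n M f)
      rcases lt_trichotomy i j with hij | rfl | hij
      · exact main i j L M hij di dj hL hM
      · rw [ih (len n (st n i * w)) (by omega) _ L M hL hM rfl]
      · exact (main j i M L hij dj di hM hL).symm

/-- symmetry of `π_w f` in the descents of `w` -/
theorem demWord_symm {n i : ℕ} {w : Equiv.Perm (Fin n)} {L : List ℕ} (h : IsRedWord n L w)
    (hd : Desc n i w) (f : MvPolynomial (Fin n) ℤ) :
    ac (st n i) (demWord n L f) = demWord n L f := by
  obtain ⟨U, hU⟩ := exists_redWord (st n i * w)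
  rw [matsumoto w L _ h (redWord_cons hU hd) f]
  obtain ⟨h0, h1, _⟩ := hd
  exact dem_symm i h0 h1 _

end LSS

namespace LSS
open MvPolynomial

theorem mono_eq (n : ℕ) (β : Fin n → ℕ) : mono n β = ∏ p, X p ^ β p := by
  unfold mono expOf
  rw [monomial_eq, Finsupp.prod_fintype _ _ (by simp)]
  simp

/-- block-preserving permutation -/
def BP {n : ℕ} {κ : Type*} (b : Fin n → κ) (w : Equiv.Perm (Fin n)) : Prop := ∀ p, b (w p) = b p

theorem BP.mul {n : ℕ} {κ : Type*} {b : Fin n → κ} {u v : Equiv.Perm (Fin n)} (hu : BP b u)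
    (hv : BP b v) : BP b (u * v) := fun p => by
  rw [Equiv.Perm.mul_apply, hu, hv]

theorem BP.inv {n : ℕ} {κ : Type*} {b : Fin n → κ} {u : Equiv.Perm (Fin n)} (hu : BP b u) :
    BP b u⁻¹ := fun p => by
  have := hu (u⁻¹ p)
  simpa using this.symm

theorem BP.one {n : ℕ} {κ : Type*} {b : Fin n → κ} : BP b (1 : Equiv.Perm (Fin n)) := fun p => rfl

theorem BP_st {n : ℕ} {κ : Type*} {b : Fin n → κ} {i : ℕ} (h0 : 0 < i) (h1 : i < n)
    (h : b ⟨i - 1, by omega⟩ = b ⟨i, h1⟩) : BP b (st n i) := by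
  intro p
  by_cases hp : p = ⟨i - 1, by omega⟩
  · rw [hp, st_apply_left h0 h1, h]
  · by_cases hp' : p = ⟨i, h1⟩
    · rw [hp', st_apply_right h0 h1, h]
    · rw [st_apply_of_ne]
      · intro e; exact hp (Fin.ext e)
      · intro e; exact hp' (Fin.ext e)

/-- antisymmetrizer over the block-preserving permutations -/
noncomputable def asym {n : ℕ} {κ : Type*} (b : Fin n → κ) (h : MvPolynomial (Fin n) ℤ) :
    MvPolynomial (Fin n) ℤ :=
  ∑ w : Equiv.Perm (Fin n), if BP b w then ((Equiv.Perm.sign w : ℤ) : MvPolynomial (Fin n) ℤ) * ac w h else 0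

theorem asym_sub {n : ℕ} {κ : Type*} (b : Fin n → κ) (f g) :
    asym b (f - g) = asym b f - asym b g := by
  unfold asym
  rw [← Finset.sum_sub_distrib]
  refine Finset.sum_congr rfl fun w _ => ?_
  split_ifs
  · rw [map_sub, mul_sub]
  · simp

theorem asym_st {n : ℕ} {κ : Type*} {b : Fin n → κ} {i : ℕ} (h0 : 0 < i) (h1 : i < n)
    (h : b ⟨i - 1, by omega⟩ = b ⟨i, h1⟩) (f) : asym b (ac (st n i) f) = - asym b f := by
  unfold asym
  rw [← Finset.sum_neg_distrib]
  refine Fintype.sum_equiv (Equiv.mulRight (st n i)) _ _ fun w => ?_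
  have hs : Equiv.Perm.sign (st n i) = -1 := by
    rw [st_eq i h0 h1, Equiv.Perm.sign_swap]
    simp only [ne_eq, Fin.ext_iff]; omega
  have hB : BP b (w * st n i) ↔ BP b w := by
    constructor
    · intro hh
      have := hh.mul (BP_st h0 h1 h)
      rwa [mul_assoc, st_mul_self, mul_one] at this
    · intro hh; exact hh.mul (BP_st h0 h1 h)
  simp only [Equiv.coe_mulRight, hB, ← ac_mul]
  split_ifs
  · rw [Equiv.Perm.sign_mul, hs]; simp
  · simp

theorem asym_dem {n : ℕ} {κ : Type*} {b : Fin n → κ} {i : ℕ} (h0 : 0 < i) (h1 : i < n)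
    (h : b ⟨i - 1, by omega⟩ = b ⟨i, h1⟩) (ρ : Fin n → ℕ)
    (hρ : ρ ⟨i - 1, by omega⟩ = ρ ⟨i, h1⟩ + 1) (f) :
    asym b (mono n ρ * dem n i f) = asym b (mono n ρ * f) := by
  have hi1 : i - 1 < n := by omega
  obtain ⟨m, hm, hms⟩ : ∃ m, mono n ρ = X ⟨i - 1, hi1⟩ * m ∧ ac (st n i) m = m := by
    refine ⟨∏ p, X p ^ (if p = ⟨i - 1, by omega⟩ then ρ ⟨i, h1⟩ else ρ p), ?_, ?_⟩
    · rw [mono_eq, ← Finset.mul_prod_erase _ _ (Finset.mem_univ (⟨i - 1, by omega⟩ : Fin n)),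
        ← Finset.mul_prod_erase (a := (⟨i - 1, by omega⟩ : Fin n)) _
          (fun p => X p ^ (if p = ⟨i - 1, by omega⟩ then ρ ⟨i, h1⟩ else ρ p)) (Finset.mem_univ _),
        ← mul_assoc, if_pos rfl, ← pow_succ', hρ]
      congr 1
      refine Finset.prod_congr rfl fun p hp => ?_
      rw [if_neg (Finset.ne_of_mem_erase hp)]
    · rw [map_prod]
      refine Fintype.prod_equiv (st n i) _ _ fun p => ?_
      rw [map_pow, ac_X]
      congr 1
      by_cases hp : p = ⟨i - 1, by omega⟩
      · rw [hp, st_apply_left h0 h1]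
        simp only [if_true]; split_ifs <;> rfl
      · by_cases hp' : p = ⟨i, h1⟩
        · rw [hp', st_apply_right h0 h1]
          simp only [if_true]; split_ifs <;> rfl
        · rw [st_apply_of_ne]
          · intro e; exact hp (Fin.ext e)
          · intro e; exact hp' (Fin.ext e)
  have sp := dem_spec i h0 h1 f
  have sy := dem_symm i h0 h1 f
  set g := dem n i f
  have sa : ac (st n i) (X ⟨i - 1, by omega⟩) = X ⟨i, h1⟩ := by
    rw [ac_X, st_apply_left h0 h1]
  have sb : ac (st n i) (X ⟨i, h1⟩) = X ⟨i - 1, by omega⟩ := by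
    rw [ac_X, st_apply_right h0 h1]
  have e1 := asym_st h0 h1 h (mono n ρ * g)
  have e2 := asym_st h0 h1 h (mono n ρ * f)
  have e3 : mono n ρ * g - ac (st n i) (mono n ρ * g) =
      mono n ρ * f - ac (st n i) (mono n ρ * f) := by
    rw [hm]
    simp only [map_mul, hms, sa, sy]
    linear_combination m * sp
  have e4 := congrArg (asym b) e3
  rw [asym_sub, asym_sub, e1, e2, sub_neg_eq_add, sub_neg_eq_add, ← two_mul, ← two_mul] at e4
  exact mul_left_cancel₀ two_ne_zero e4

theorem asym_mul {n : ℕ} {κ : Type*} {b : Fin n → κ} (h F : MvPolynomial (Fin n) ℤ)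
    (hF : ∀ w, BP b w → ac w F = F) : asym b (h * F) = asym b h * F := by
  unfold asym
  rw [Finset.sum_mul]
  refine Finset.sum_congr rfl fun w _ => ?_
  split_ifs with hw
  · rw [map_mul, hF w hw, mul_assoc]
  · simp

theorem desc_block {n : ℕ} {κ : Type*} [LinearOrder κ] {b : Fin n → κ} (hb : Monotone b)
    {w : Equiv.Perm (Fin n)} (hw : BP b w) {i : ℕ} (h0 : 0 < i) (h1 : i < n) (hi : Desc n i w) :
    b ⟨i - 1, by omega⟩ = b ⟨i, h1⟩ := by
  obtain ⟨_, _, h⟩ := hi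
  apply le_antisymm
  · apply hb; simp [Fin.le_def]
  · have := hb h.le
    rwa [hw.inv, hw.inv] at this

theorem ac_of_gen {n : ℕ} {κ : Type*} [LinearOrder κ] {b : Fin n → κ} (hb : Monotone b)
    (F : MvPolynomial (Fin n) ℤ)
    (hF : ∀ i (_ : 0 < i) (h1 : i < n), b ⟨i - 1, by omega⟩ = b ⟨i, h1⟩ → ac (st n i) F = F)
    (w : Equiv.Perm (Fin n)) (hw : BP b w) : ac w F = F := by
  induction hl : len n w using Nat.strong_induction_on generalizing w with
  | _ l ih =>
    by_cases h : w = 1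
    · rw [h, ac_one]
    · obtain ⟨i, hi⟩ := exists_desc w h
      have hi' := hi
      obtain ⟨h0, h1, _⟩ := hi'
      have hbi := desc_block hb hw h0 h1 hi
      have hlen := len_st_down i w hi
      have e := ih (len n (st n i * w)) (by omega) (st n i * w) ((BP_st h0 h1 hbi).mul hw) rfl
      have e2 : w = st n i * (st n i * w) := by rw [← mul_assoc, st_mul_self, one_mul]
      rw [e2, ac_mul, e, hF i h0 h1 hbi]

theorem asym_demWord {n : ℕ} {κ : Type*} [LinearOrder κ] {b : Fin n → κ} (hb : Monotone b)
    (ρ : Fin n → ℕ)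
    (hρ : ∀ i (_ : 0 < i) (h1 : i < n), b ⟨i - 1, by omega⟩ = b ⟨i, h1⟩ →
      ρ ⟨i - 1, by omega⟩ = ρ ⟨i, h1⟩ + 1) (f) (L : List ℕ) (w : Equiv.Perm (Fin n))
    (hw : BP b w) (hL : IsRedWord n L w) :
    asym b (mono n ρ * demWord n L f) = asym b (mono n ρ * f) := by
  induction L generalizing w with
  | nil => rfl
  | cons i L ih =>
    obtain ⟨hi, hL'⟩ := redWord_uncons hL
    have hi' := hi
    obtain ⟨h0, h1, _⟩ := hi'
    have hbi := desc_block hb hw h0 h1 hi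
    have e := ih (st n i * w) ((BP_st h0 h1 hbi).mul hw) hL'
    rw [← e]
    exact asym_dem h0 h1 hbi ρ (hρ i h0 h1 hbi) _

theorem asym_main {n : ℕ} {κ : Type*} [LinearOrder κ] {b : Fin n → κ} (hb : Monotone b)
    (ρ : Fin n → ℕ)
    (hρ : ∀ i (_ : 0 < i) (h1 : i < n), b ⟨i - 1, by omega⟩ = b ⟨i, h1⟩ →
      ρ ⟨i - 1, by omega⟩ = ρ ⟨i, h1⟩ + 1) (f) (L : List ℕ) (w : Equiv.Perm (Fin n))
    (hw : BP b w) (hL : IsRedWord n L w)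
    (hlong : ∀ i (_ : 0 < i) (h1 : i < n), b ⟨i - 1, by omega⟩ = b ⟨i, h1⟩ → Desc n i w) :
    asym b (mono n ρ) * demWord n L f = asym b (mono n ρ * f) := by
  rw [← asym_demWord hb ρ hρ f L w hw hL, asym_mul]
  intro u hu
  refine ac_of_gen hb _ ?_ u hu
  intro i h0 h1 hbi
  exact demWord_symm hL (hlong i h0 h1 hbi) f

/-- The antisymmetrized monomial is a determinant. -/
theorem asym_mono {n : ℕ} {κ : Type*} (b : Fin n → κ) (α : Fin n → ℕ) :
    asym b (mono n α) = (Matrix.of fun i j : Fin n =>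
      if b j = b i then (X j ^ α i : MvPolynomial (Fin n) ℤ) else 0).det := by
  rw [← Matrix.det_transpose, Matrix.det_apply']
  unfold asym
  refine Finset.sum_congr rfl fun w _ => ?_
  split_ifs with h
  · congr 1
    rw [mono_eq, map_prod]
    refine Finset.prod_congr rfl fun p _ => ?_
    rw [map_pow, ac_X, Matrix.transpose_apply, Matrix.of_apply, if_pos (h p)]
  · unfold BP at h
    push Not at h
    obtain ⟨p, hp⟩ := h
    rw [Finset.prod_eq_zero (Finset.mem_univ p), mul_zero]
    rw [Matrix.transpose_apply, Matrix.of_apply, if_neg hp]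

theorem asym_mono_prod {n : ℕ} {κ : Type*} [LinearOrder κ] [Fintype κ] (b : Fin n → κ)
    (α : Fin n → ℕ) (m : κ → ℕ) (e : ∀ t, Fin (m t) ≃ {p : Fin n // b p = t}) :
    asym b (mono n α) = ∏ t, (Matrix.of fun i j : Fin (m t) =>
      (X (e t j).1 ^ α (e t i).1 : MvPolynomial (Fin n) ℤ)).det := by
  rw [asym_mono, Matrix.BlockTriangular.det_fintype (b := b)]
  · refine Finset.prod_congr rfl fun t _ => ?_
    rw [← Matrix.det_submatrix_equiv_self (e t)]
    congr 1
    ext1 i j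
    simp only [Matrix.submatrix_apply, Matrix.toSquareBlock_def, Matrix.of_apply]
    rw [if_pos]
    rw [(e t j).2, (e t i).2]
  · intro i j hij
    rw [Matrix.of_apply, if_neg hij.ne]

end LSS

namespace LSS
open MvPolynomial

theorem hPoly_zero (n : ℕ) (S : Finset (Fin n)) : hPoly n S 0 = 1 := by
  unfold hPoly
  rw [Finset.sym_zero, Finset.sum_singleton]
  change (Multiset.map X (0 : Multiset (Fin n))).prod = 1
  simp

theorem hPoly_empty (n N : ℕ) : hPoly n ∅ (N + 1) = 0 := by
  unfold hPoly
  simp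

theorem hPoly_insert (n : ℕ) (S : Finset (Fin n)) (a : Fin n) (ha : a ∉ S) (N : ℕ) :
    hPoly n (insert a S) (N + 1) = hPoly n S (N + 1) + X a * hPoly n (insert a S) N := by
  unfold hPoly
  rw [← Finset.sum_filter_add_sum_filter_not _ (fun f : Sym (Fin n) (N + 1) => a ∉ f)]
  congr 1
  · refine Finset.sum_congr ?_ fun _ _ => rfl
    ext f
    simp only [Finset.mem_filter, Finset.mem_sym_iff, Finset.mem_insert]
    constructor
    · rintro ⟨h1, h2⟩ x hx
      rcases h1 x hx with rfl | h
      · exact absurd hx h2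
      · exact h
    · intro h
      exact ⟨fun x hx => Or.inr (h x hx), fun h2 => ha (h a h2)⟩
  · rw [Finset.mul_sum]
    symm
    refine Finset.sum_bij (fun f _ => a ::ₛ f) ?_ ?_ ?_ ?_
    · intro f hf
      simp only [Finset.mem_filter, Finset.mem_sym_iff, Finset.mem_insert, Sym.mem_cons] at hf ⊢
      refine ⟨?_, by simp⟩
      rintro x (rfl | hx)
      · exact Or.inl rfl
      · exact hf x hx
    · intro f _ g _ h
      exact Sym.cons_inj_right a _ _ |>.1 h
    · intro f hf
      simp only [Finset.mem_filter, Finset.mem_sym_iff, Finset.mem_insert, not_not] at hf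
      refine ⟨f.erase a hf.2, ?_, Sym.cons_erase hf.2⟩
      rw [Finset.mem_sym_iff]
      intro x hx
      rw [Finset.mem_insert]
      refine hf.1 x ?_
      rw [← Sym.cons_erase hf.2]
      exact Sym.mem_cons_of_mem hx
    · intro f _
      rw [Sym.coe_cons, Multiset.map_cons, Multiset.prod_cons]

theorem hPoly_gen (n : ℕ) (S : Finset (Fin n)) :
    (∏ l ∈ S, (1 - PowerSeries.C (X l : MvPolynomial (Fin n) ℤ) * PowerSeries.X)) *
      PowerSeries.mk (hPoly n S) = 1 := by
  induction S using Finset.induction_on with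
  | empty =>
    ext1 N
    rw [Finset.prod_empty, one_mul, PowerSeries.coeff_mk, PowerSeries.coeff_one]
    cases N with
    | zero => simp [hPoly_zero]
    | succ N => simp [hPoly_empty]
  | insert a S ha ih =>
    rw [Finset.prod_insert ha, mul_comm (1 - _), mul_assoc]
    have : (1 - PowerSeries.C (X a : MvPolynomial (Fin n) ℤ) * PowerSeries.X) *
        PowerSeries.mk (hPoly n (insert a S)) = PowerSeries.mk (hPoly n S) := by
      ext1 N
      rw [sub_mul, one_mul, mul_assoc, map_sub, PowerSeries.coeff_C_mul, PowerSeries.coeff_mk,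
        PowerSeries.coeff_mk]
      cases N with
      | zero => simp [hPoly_zero]
      | succ N =>
        rw [PowerSeries.coeff_succ_X_mul, PowerSeries.coeff_mk, hPoly_insert n S a ha]
        ring
    rw [this, ih]

/-- `∏_{l ∈ S, l ≠ j} (1 - x_l t)`. -/
noncomputable def PJ (n : ℕ) (S : Finset (Fin n)) (j : Fin n) :
    Polynomial (MvPolynomial (Fin n) ℤ) :=
  ∏ l ∈ S.erase j, (1 - Polynomial.C (X l : MvPolynomial (Fin n) ℤ) * Polynomial.X)

theorem PJ_coeff_zero (n : ℕ) (S : Finset (Fin n)) (j : Fin n) (hj : j ∈ S) (k : ℕ)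
    (hk : S.card ≤ k) : (PJ n S j).coeff k = 0 := by
  apply Polynomial.coeff_eq_zero_of_natDegree_lt
  have h1 : (PJ n S j).natDegree ≤ ∑ l ∈ S.erase j, 1 := by
    unfold PJ
    refine (Polynomial.natDegree_prod_le _ _).trans (Finset.sum_le_sum fun l _ => ?_)
    compute_degree
  rw [Finset.sum_const, Finset.card_erase_of_mem hj] at h1
  have : 0 < S.card := Finset.card_pos.2 ⟨j, hj⟩
  simp at h1
  omega

theorem PJ_gen (n : ℕ) (S : Finset (Fin n)) (j : Fin n) (hj : j ∈ S) :
    ((PJ n S j : Polynomial (MvPolynomial (Fin n) ℤ)) : PowerSeries (MvPolynomial (Fin n) ℤ)) *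
      PowerSeries.mk (hPoly n S) = PowerSeries.mk (fun N => (X j : MvPolynomial (Fin n) ℤ) ^ N) := by
  have h1 := hPoly_gen n S
  rw [← Finset.mul_prod_erase _ _ hj] at h1
  have hP : ((PJ n S j : Polynomial (MvPolynomial (Fin n) ℤ)) :
      PowerSeries (MvPolynomial (Fin n) ℤ)) =
      ∏ l ∈ S.erase j, (1 - PowerSeries.C (X l : MvPolynomial (Fin n) ℤ) * PowerSeries.X) := by
    unfold PJ
    rw [← Polynomial.coeToPowerSeries.ringHom_apply, map_prod]
    simp
  rw [← hP] at h1
  have h2 : (1 - PowerSeries.C (X j : MvPolynomial (Fin n) ℤ) * PowerSeries.X) *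
      PowerSeries.mk (fun N => (X j : MvPolynomial (Fin n) ℤ) ^ N) = 1 := by
    ext1 N
    rw [sub_mul, one_mul, mul_assoc, map_sub, PowerSeries.coeff_C_mul, PowerSeries.coeff_mk]
    cases N with
    | zero => simp
    | succ N =>
      rw [PowerSeries.coeff_succ_X_mul, PowerSeries.coeff_mk, PowerSeries.coeff_one]
      simp [pow_succ']
  rw [mul_comm] at h2
  rw [mul_assoc] at h1
  exact (left_inv_eq_right_inv h2 h1).symm

theorem X_pow_eq (n : ℕ) (S : Finset (Fin n)) (j : Fin n) (hj : j ∈ S) (N : ℕ) :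
    (X j : MvPolynomial (Fin n) ℤ) ^ N =
      ∑ k ∈ Finset.range S.card, (PJ n S j).coeff k * hZ n S ((N : ℤ) - k) := by
  have h := congrArg (PowerSeries.coeff N) (PJ_gen n S j hj)
  rw [PowerSeries.coeff_mul, PowerSeries.coeff_mk, Finset.Nat.sum_antidiagonal_eq_sum_range_succ_mk] at h
  rw [← h]
  have e1 : ∀ k ∈ Finset.range N.succ,
      (PowerSeries.coeff (k, N - k).1) ((PJ n S j : Polynomial (MvPolynomial (Fin n) ℤ)) :
        PowerSeries (MvPolynomial (Fin n) ℤ)) *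
      (PowerSeries.coeff (k, N - k).2) (PowerSeries.mk (hPoly n S)) =
      (PJ n S j).coeff k * hZ n S ((N : ℤ) - k) := by
    intro k hk
    rw [Finset.mem_range] at hk
    rw [Polynomial.coeff_coe, PowerSeries.coeff_mk]
    unfold hZ
    rw [if_pos (by omega)]
    congr 2
    simp only; omega
  rw [Finset.sum_congr rfl e1]
  have c1 : ∑ k ∈ Finset.range N.succ, (PJ n S j).coeff k * hZ n S ((N : ℤ) - k) =
      ∑ k ∈ Finset.range (max N.succ S.card), (PJ n S j).coeff k * hZ n S ((N : ℤ) - k) := by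
    refine Finset.sum_subset (by simp) fun k _ hk => ?_
    rw [Finset.mem_range, not_lt] at hk
    unfold hZ
    rw [if_neg (by omega), mul_zero]
  have c2 : ∑ k ∈ Finset.range S.card, (PJ n S j).coeff k * hZ n S ((N : ℤ) - k) =
      ∑ k ∈ Finset.range (max N.succ S.card), (PJ n S j).coeff k * hZ n S ((N : ℤ) - k) := by
    refine Finset.sum_subset (by simp) fun k _ hk => ?_
    rw [Finset.mem_range, not_lt] at hk
    rw [PJ_coeff_zero n S j hj k hk, zero_mul]
  rw [c1, c2]

/-- one-block Jacobi-Trudi matrix for an arbitrary composition -/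
noncomputable def JT (n : ℕ) (S : Finset (Fin n)) (m : ℕ) (β : Fin m → ℕ) :
    Matrix (Fin m) (Fin m) (MvPolynomial (Fin n) ℤ) :=
  Matrix.of fun i j : Fin m => hZ n S ((β i : ℤ) - (i.1 + 1) + (j.1 + 1))

theorem JT_mul (n : ℕ) (S : Finset (Fin n)) (m : ℕ) (hm : S.card = m) (v : Fin m → Fin n)
    (hv : ∀ i, v i ∈ S) (β : Fin m → ℕ) :
    (Matrix.of fun i j : Fin m => (X (v j) : MvPolynomial (Fin n) ℤ) ^ (β i + (m - 1 - i.1))) =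
      JT n S m β * Matrix.of fun c j : Fin m => (PJ n S (v j)).coeff (m - 1 - c.1) := by
  ext1 i j
  rw [Matrix.of_apply, Matrix.mul_apply, X_pow_eq n S (v j) (hv j), hm, Finset.sum_range]
  refine Fintype.sum_equiv Fin.revPerm _ _ fun c => ?_
  rw [JT, Matrix.of_apply, Matrix.of_apply, mul_comm]
  have h1 : m - 1 - (Fin.revPerm c).1 = c.1 := by
    simp [Fin.revPerm_apply, Fin.val_rev]; omega
  have h2 : ((Fin.revPerm c).1 : ℤ) = (m : ℤ) - 1 - c.1 := by
    simp only [Fin.revPerm_apply, Fin.val_rev]; omega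
  rw [h1, h2]
  congr 2
  have := i.2
  push_cast
  omega

theorem JT_zero_det (n : ℕ) (S : Finset (Fin n)) (m : ℕ) :
    (JT n S m (fun _ => 0)).det = 1 := by
  rw [Matrix.det_of_isUpperTriangular]
  · apply Finset.prod_eq_one
    intro i _
    simp [JT, hZ, hPoly_zero]
  · intro i j hij
    simp only [id, Fin.lt_def] at hij
    rw [JT, Matrix.of_apply]
    unfold hZ
    rw [if_neg]
    push_cast; omega

theorem block_det (n : ℕ) (S : Finset (Fin n)) (m : ℕ) (hm : S.card = m) (v : Fin m → Fin n)
    (hv : ∀ i, v i ∈ S) (β : Fin m → ℕ) :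
    (Matrix.of fun i j : Fin m =>
      (X (v j) : MvPolynomial (Fin n) ℤ) ^ (β i + (m - 1 - i.1))).det =
    (JT n S m β).det * (Matrix.of fun i j : Fin m =>
      (X (v j) : MvPolynomial (Fin n) ℤ) ^ (m - 1 - i.1)).det := by
  have h0 := JT_mul n S m hm v hv (fun _ => 0)
  simp only [zero_add] at h0
  rw [JT_mul n S m hm v hv β, h0, Matrix.det_mul, Matrix.det_mul, JT_zero_det, one_mul]

theorem vander_ne (n m : ℕ) (v : Fin m → Fin n) (hv : Function.Injective v) :
    (Matrix.of fun i j : Fin m =>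
      (X (v j) : MvPolynomial (Fin n) ℤ) ^ (m - 1 - i.1)).det ≠ 0 := by
  have h := (Matrix.det_vandermonde_ne_zero_iff
    (v := fun j => (X (v j) : MvPolynomial (Fin n) ℤ))).2 (fun a b h => hv (X_injective h))
  have e : (Matrix.of fun i j : Fin m =>
      (X (v j) : MvPolynomial (Fin n) ℤ) ^ (m - 1 - i.1)) =
      ((Matrix.vandermonde (fun j => (X (v j) : MvPolynomial (Fin n) ℤ))).transpose).submatrix
        Fin.revPerm id := by
    ext1 i j
    simp only [Matrix.of_apply, Matrix.submatrix_apply, Matrix.transpose_apply,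
      Matrix.vandermonde_apply, id, Fin.revPerm_apply, Fin.val_rev]
    congr 1
    omega
  rw [e, Matrix.det_permute, Matrix.det_transpose]
  refine mul_ne_zero ?_ h
  rcases Int.units_eq_one_or (Equiv.Perm.sign (Fin.revPerm (n := m))) with h | h <;> rw [h] <;> simp

/-- straightening of one block -/
theorem JT_straighten (n : ℕ) (S : Finset (Fin n)) (m : ℕ) (β : Fin m → ℕ) :
    (JT n S m β).det = 0 ∨ ∃ lam : ℕ → ℕ, (lam 0 = 0 ∧
      (∀ a b : ℕ, 1 ≤ a → a ≤ b → lam b ≤ lam a) ∧ ∀ k, m < k → lam k = 0) ∧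
      ((JT n S m β).det = schurP n S m lam ∨ (JT n S m β).det = - schurP n S m lam) := by
  set r : Fin m → ℤ := fun i => (i.1 : ℤ) - β i with hr
  by_cases hinj : Function.Injective r
  · right
    set σ := Tuple.sort r
    have hmono : Monotone (r ∘ σ) := Tuple.monotone_sort r
    have hsm : StrictMono (r ∘ σ) := hmono.strictMono_of_injective (hinj.comp σ.injective)
    have hgap : ∀ (k : ℕ) (i j : Fin m), i.1 + k = j.1 → r (σ i) + k ≤ r (σ j) := by
      intro k
      induction k with
      | zero => intro i j h; have : i = j := Fin.ext (by omega); simp [this]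
      | succ k ih =>
        intro i j h
        have := ih i ⟨j.1 - 1, by omega⟩ (by simp only; omega)
        have h2 : r (σ ⟨j.1 - 1, by omega⟩) < r (σ j) := hsm (by simp only [Fin.lt_def]; omega)
        push_cast; omega
    have hle : ∀ i : Fin m, r (σ i) ≤ i.1 := by
      intro i
      have hi := i.2
      have h1 := hgap (m - 1 - i.1) i ⟨m - 1, by omega⟩ (by simp only; omega)
      have h2 : r (σ ⟨m - 1, by omega⟩) ≤ (m : ℤ) - 1 := by
        have h3 := (σ ⟨m - 1, by omega⟩).2
        simp only [r]; omega
      omega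
    refine ⟨fun a => if h : 1 ≤ a ∧ a ≤ m then ((a : ℤ) - 1 - r (σ ⟨a - 1, by omega⟩)).toNat else 0,
      ⟨by simp, ?_, ?_⟩, ?_⟩
    · intro a b ha hab
      by_cases hb : b ≤ m
      · simp only
        rw [dif_pos ⟨by omega, hb⟩, dif_pos ⟨ha, by omega⟩]
        have := hgap (b - a) ⟨a - 1, by omega⟩ ⟨b - 1, by omega⟩ (by simp only; omega)
        omega
      · simp only
        rw [dif_neg (by omega)]; omega
    · intro k hk
      simp only
      rw [dif_neg (by omega)]
    · have key : ∀ lam : ℕ → ℕ, (∀ i : Fin m, (lam (i.1 + 1) : ℤ) = i.1 - r (σ i)) →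
          schurP n S m lam = ((JT n S m β).submatrix σ id).det := by
        intro lam hlam
        unfold schurP
        congr 1
        ext1 i j
        rw [Matrix.submatrix_apply, JT, Matrix.of_apply, Matrix.of_apply, hlam]
        congr 1
        simp only [r, id]; omega
      rw [key, Matrix.det_permute]
      · rcases Int.units_eq_one_or (Equiv.Perm.sign σ) with h | h <;> rw [h] <;> simp
      · intro i
        rw [dif_pos ⟨by omega, by omega⟩]
        have := hle i
        simp only [Nat.add_sub_cancel, Fin.eta]
        rw [Int.toNat_of_nonneg] <;> push_cast <;> omega
  · left
    unfold Function.Injective at hinj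
    push Not at hinj
    obtain ⟨i, j, hij, hne⟩ := hinj
    refine Matrix.det_zero_of_row_eq hne ?_
    funext c
    simp only [JT, Matrix.of_apply]
    congr 1
    simp only [r] at hij
    omega

end LSS

namespace LSS
open MvPolynomial

theorem exists_block {n k : ℕ} {d : Fin (k + 2) → ℕ} (hd : BlockData n k d) (p : Fin n) :
    ∃ t : Fin (k + 1), d t.castSucc ≤ p.1 ∧ p.1 < d t.succ := by
  obtain ⟨h0, h1, _⟩ := hd
  have key : ∀ j : Fin (k + 2), p.1 < d j → ∃ t : Fin (k + 1), d t.castSucc ≤ p.1 ∧ p.1 < d t.succ := by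
    intro j
    induction j using Fin.induction with
    | zero => intro h; omega
    | succ j ih =>
      intro h
      by_cases hj : p.1 < d j.castSucc
      · exact ih hj
      · exact ⟨j, by omega, h⟩
  exact key (Fin.last (k + 1)) (by rw [h1]; exact p.2)

/-- the block containing a position -/
noncomputable def blk {n k : ℕ} {d : Fin (k + 2) → ℕ} (hd : BlockData n k d) (p : Fin n) :
    Fin (k + 1) := (exists_block hd p).choose

theorem blk_le {n k : ℕ} {d : Fin (k + 2) → ℕ} (hd : BlockData n k d) (p q : Fin n)
    (t s : Fin (k + 1)) (ht : d t.castSucc ≤ p.1) (hs : q.1 < d s.succ) (hpq : p ≤ q) : t ≤ s := by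
  by_contra h
  rw [not_le] at h
  have : d s.succ ≤ d t.castSucc := hd.2.2.monotone (by
    simp only [Fin.le_def, Fin.val_succ, Fin.val_castSucc]; omega)
  rw [Fin.le_def] at hpq
  omega

theorem blk_spec {n k : ℕ} {d : Fin (k + 2) → ℕ} (hd : BlockData n k d) (p : Fin n) :
    d (blk hd p).castSucc ≤ p.1 ∧ p.1 < d (blk hd p).succ := (exists_block hd p).choose_spec

theorem blk_eq {n k : ℕ} {d : Fin (k + 2) → ℕ} (hd : BlockData n k d) (p : Fin n)
    (t : Fin (k + 1)) : blk hd p = t ↔ d t.castSucc ≤ p.1 ∧ p.1 < d t.succ := by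
  constructor
  · rintro rfl; exact blk_spec hd p
  · intro h
    have h2 := blk_spec hd p
    exact le_antisymm (blk_le hd p p _ _ h2.1 h.2 le_rfl) (blk_le hd p p _ _ h.1 h2.2 le_rfl)

theorem blk_mono {n k : ℕ} {d : Fin (k + 2) → ℕ} (hd : BlockData n k d) : Monotone (blk hd) :=
  fun p q h => blk_le hd p q _ _ (blk_spec hd p).1 (blk_spec hd q).2 h

theorem blk_iff {n k : ℕ} {d : Fin (k + 2) → ℕ} (hd : BlockData n k d) (i : ℕ) (h0 : 0 < i)
    (h1 : i < n) : blk hd ⟨i - 1, by omega⟩ = blk hd ⟨i, h1⟩ ↔ i ∈ Iset n k d := by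
  constructor
  · intro h
    refine ⟨h0, by omega, ?_⟩
    rintro ⟨s, -, -, hs⟩
    have a := blk_spec hd ⟨i, h1⟩
    have b := blk_spec hd ⟨i - 1, by omega⟩
    rw [h] at b
    simp only at a b
    have c1 := hd.2.2.lt_iff_lt.1 (show d (blk hd ⟨i, h1⟩).castSucc < d s by omega)
    have c2 := hd.2.2.lt_iff_lt.1 (show d s < d (blk hd ⟨i, h1⟩).succ by omega)
    simp only [Fin.lt_def, Fin.val_castSucc, Fin.val_succ] at c1 c2
    omega
  · rintro ⟨_, _, h⟩
    have b := blk_spec hd ⟨i - 1, by omega⟩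
    simp only at b
    symm
    rw [blk_eq]
    simp only
    refine ⟨by omega, ?_⟩
    refine lt_of_le_of_ne (by omega) ?_
    intro e
    apply h
    refine ⟨_, Fin.succ_ne_zero _, ?_, e.symm⟩
    intro e2
    rw [e2, hd.2.1] at e
    omega

/-- enumeration of a block -/
noncomputable def blkEquiv {n k : ℕ} {d : Fin (k + 2) → ℕ} (hd : BlockData n k d)
    (t : Fin (k + 1)) : Fin (d t.succ - d t.castSucc) ≃ {p : Fin n // blk hd p = t} where
  toFun i := ⟨⟨d t.castSucc + i.1, by
      have h : d t.succ ≤ d (Fin.last (k + 1)) := hd.2.2.monotone (Fin.le_last _)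
      rw [hd.2.1] at h
      omega⟩, by rw [blk_eq]; simp only; omega⟩
  invFun p := ⟨p.1.1 - d t.castSucc, by have := (blk_eq hd p.1 t).1 p.2; omega⟩
  left_inv i := by ext; simp
  right_inv p := by
    have := (blk_eq hd p.1 t).1 p.2
    ext
    simp only
    omega

theorem st_BP_of_mem {n k : ℕ} {d : Fin (k + 2) → ℕ} (hd : BlockData n k d)
    (w : Equiv.Perm (Fin n)) (hw : w ∈ parab n (Iset n k d)) : BP (blk hd) w := by
  unfold parab at hw
  induction hw using Subgroup.closure_induction with
  | mem x hx =>
    obtain ⟨i, hi, rfl⟩ := hx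
    have h0 : 0 < i := hi.1
    have h1 : i < n := by have := hi.2.1; omega
    exact BP_st h0 h1 ((blk_iff hd i h0 h1).2 hi)
  | one => exact BP.one
  | mul x y _ _ hx hy => exact hx.mul hy
  | inv x _ hx => exact hx.inv

theorem demWord_eq_prod (n k : ℕ) (d : Fin (k + 2) → ℕ) (hd : BlockData n k d)
    (w0I : Equiv.Perm (Fin n)) (h0 : IsLongest n (Iset n k d) w0I)
    (β : Fin n → ℕ) (L : List ℕ) (hL : IsRedWord n L w0I) :
    demWord n L (mono n β) = ∏ t : Fin (k + 1),
      (JT n (blockVars n k d t) (d t.succ - d t.castSucc) (fun i => β (blkEquiv hd t i).1)).det := by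
  set ρ : Fin n → ℕ := fun p => d (blk hd p).succ - 1 - p.1 with hρdef
  have hBP := st_BP_of_mem hd w0I h0.1
  have hmain := asym_main (blk_mono hd) ρ (by
    intro i h0 h1 h
    simp only [ρ]
    rw [h]
    have := (blk_spec hd ⟨i, h1⟩).2
    simp only at this
    omega) (mono n β) L w0I hBP hL (by
    intro i hi0 hi1 h
    have hi := (blk_iff hd i hi0 hi1).1 h
    apply desc_of_len i hi0 hi1
    have := h0.2 (st n i * w0I) (Subgroup.mul_mem _ (Subgroup.subset_closure ⟨i, hi, rfl⟩) h0.1)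
    omega)
  have hmul : mono n ρ * mono n β = mono n (fun p => β p + ρ p) := by
    rw [mono_eq, mono_eq, mono_eq, ← Finset.prod_mul_distrib]
    refine Finset.prod_congr rfl fun p _ => ?_
    rw [← pow_add, add_comm]
  have hρe : ∀ t (i : Fin (d t.succ - d t.castSucc)),
      ρ (blkEquiv hd t i).1 = (d t.succ - d t.castSucc) - 1 - i.1 := by
    intro t i
    simp only [ρ]
    rw [(blkEquiv hd t i).2]
    simp only [blkEquiv, Equiv.coe_fn_mk]
    omega
  have hcard : ∀ t, (blockVars n k d t).card = d t.succ - d t.castSucc := by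
    intro t
    have h1 : blockVars n k d t = Finset.univ.filter (fun p => blk hd p = t) := by
      unfold blockVars
      ext p
      rw [Finset.mem_filter, Finset.mem_filter, blk_eq]
    rw [h1, ← Fintype.card_subtype, ← Fintype.card_congr (blkEquiv hd t), Fintype.card_fin]
  have hmem : ∀ t i, (blkEquiv hd t i).1 ∈ blockVars n k d t := by
    intro t i
    unfold blockVars
    rw [Finset.mem_filter]
    exact ⟨Finset.mem_univ _, (blk_eq hd _ t).1 (blkEquiv hd t i).2⟩
  rw [hmul, asym_mono_prod _ _ _ (blkEquiv hd), asym_mono_prod _ _ _ (blkEquiv hd)] at hmain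
  simp only [hρe] at hmain
  have e : ∀ t, (Matrix.of fun i j : Fin (d t.succ - d t.castSucc) =>
      (X (blkEquiv hd t j).1 : MvPolynomial (Fin n) ℤ) ^
        (β (blkEquiv hd t i).1 + (d t.succ - d t.castSucc - 1 - i.1))).det = _ :=
    fun t => block_det n (blockVars n k d t) _ (hcard t) (fun j => (blkEquiv hd t j).1) (hmem t)
      (fun i => β (blkEquiv hd t i).1)
  rw [Finset.prod_congr rfl (fun t _ => e t), Finset.prod_mul_distrib, mul_comm] at hmain
  refine mul_right_cancel₀ ?_ hmain
  rw [Finset.prod_ne_zero_iff]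
  intro t _
  exact vander_ne n _ _ (fun a b h => (blkEquiv hd t).injective (Subtype.ext h))

/-- Lemma 4.10: `π_{w_0(I)}(x^β)` is either `0` or `± s_{α^1,…,α^{k+1}}`
for some `(α^1,…,α^{k+1}) ∈ Par_D`. -/
theorem stmt10 (n k : ℕ) (d : Fin (k + 2) → ℕ) (hd : BlockData n k d)
    (w0I : Equiv.Perm (Fin n)) (h0 : IsLongest n (Iset n k d) w0I)
    (β : Fin n → ℕ) (L : List ℕ) (hL : IsRedWord n L w0I) :
    demWord n L (mono n β) = 0 ∨
      ∃ γ : Fin (k + 1) → ℕ → ℕ, ParD k d γ ∧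
        (demWord n L (mono n β) = dSchur n k d γ ∨
         demWord n L (mono n β) = -dSchur n k d γ) := by
  rw [demWord_eq_prod n k d hd w0I h0 β L hL]
  have hs := fun t : Fin (k + 1) => JT_straighten n (blockVars n k d t)
    (d t.succ - d t.castSucc) (fun i => β (blkEquiv hd t i).1)
  by_cases hz : ∃ t, (JT n (blockVars n k d t) (d t.succ - d t.castSucc)
    (fun i => β (blkEquiv hd t i).1)).det = 0
  · left
    obtain ⟨t, ht⟩ := hz
    exact Finset.prod_eq_zero (Finset.mem_univ t) ht
  · right
    push Not at hz
    have hs' := fun t => (hs t).resolve_left (hz t)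
    choose γ hγ hsgn using hs'
    refine ⟨γ, hγ, ?_⟩
    unfold dSchur
    have key : ∀ T : Finset (Fin (k + 1)),
        ∏ t ∈ T, (JT n (blockVars n k d t) (d t.succ - d t.castSucc)
          (fun i => β (blkEquiv hd t i).1)).det =
          ∏ t ∈ T, schurP n (blockVars n k d t) (d t.succ - d t.castSucc) (γ t) ∨
        ∏ t ∈ T, (JT n (blockVars n k d t) (d t.succ - d t.castSucc)
          (fun i => β (blkEquiv hd t i).1)).det =
          - ∏ t ∈ T, schurP n (blockVars n k d t) (d t.succ - d t.castSucc) (γ t) := by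
      intro T
      induction T using Finset.induction_on with
      | empty => left; simp
      | insert a T ha ih =>
        rw [Finset.prod_insert ha, Finset.prod_insert ha]
        rcases hsgn a with h | h <;> rcases ih with h' | h' <;> rw [h, h']
        · left; rfl
        · right; ring
        · right; ring
        · left; ring
    exact key Finset.univ

end LSS
end
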